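/- arXiv:1008.4952 — 4 statements merged into one kernel-verified Lean document; each statement's English description precedes it below -/
import Mathlib

section
/- Let G be a group with finite symmetric generating set S, acting by isometries on a δ-hyperbolic geodesic metric space Y with basepoint p. Let K = K(δ) be a constant such that every (2,4)-quasigeodesic in a δ-hyperbolic geodesic space is contained in the K-neighborhood of any geodesic with the same endpoints. Fix C₁ > 0 and ε > 0. Then there are constants C₂ > 0 and C₃ depending only on C₁, ε and δ, and a constant C₄ depending only on the action of (G,S) on Y, such that the following holds for all sufficiently large n: let g ∈ G, let γ be a geodesic in Y from p to g(p) of length n, and let γ₁, γ₂, … be the successive nonoverlapping oriented subsegments of γ of length C₁·log n. If #{ i : γᵢ is K anti-aligned with some oriented subsegment γ' of γ } < n^{1−ε}, then there is a homogeneous quasimorphism φ on G satisfying: (1) φ(g) ≥ C₂·n/log n; (2) D(φ) ≤ C₃; and (3) |φ(h)| ≤ 2·|h|_S·C₄/log n for every h ∈ G. -/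
/-!
STATEMENT 11 (Proposition `lower_bound_template`): the abstract template for obtaining
lower bounds on quasimorphisms from geodesics with few anti-aligned subsegments.
The constants `C₂, C₃` depend only on `C₁, ε, δ` (and the constant `K = K(δ)`), so
they are quantified before the group, the space and the action; `C₄` depends only on
the action and is quantified after them.
-/

universe u v

namespace SclPaper

section MetricDefs

variable {Y : Type*} [MetricSpace Y]

/-- `γ` restricted to `[a,b]` is a unit-speed geodesic. -/
def IsGeodesicOn (γ : ℝ → Y) (a b : ℝ) : Prop :=
  ∀ s ∈ Set.Icc a b, ∀ t ∈ Set.Icc a b, dist (γ s) (γ t) = |s - t|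

/-- `γ` is a unit-speed geodesic from `x` to `y`, parameterized on `[0, dist x y]`. -/
def GeodesicFromTo (γ : ℝ → Y) (x y : Y) : Prop :=
  γ 0 = x ∧ γ (dist x y) = y ∧ IsGeodesicOn γ 0 (dist x y)

/-- A geodesic metric space: any two points are joined by a geodesic. -/
def GeodesicSpace (Y : Type*) [MetricSpace Y] : Prop :=
  ∀ x y : Y, ∃ γ : ℝ → Y, GeodesicFromTo γ x y

/-- `Y` is `δ`-hyperbolic: geodesic triangles are `δ`-thin (each side is contained in the
`δ`-neighborhood of the union of the other two sides). -/
def GromovHyperbolic (Y : Type*) [MetricSpace Y] (δ : ℝ) : Prop :=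
  ∀ (x y z : Y) (γ₁ γ₂ γ₃ : ℝ → Y),
    GeodesicFromTo γ₁ x y → GeodesicFromTo γ₂ y z → GeodesicFromTo γ₃ z x →
    ∀ s ∈ Set.Icc (0 : ℝ) (dist x y),
      (∃ t ∈ Set.Icc (0 : ℝ) (dist y z), dist (γ₁ s) (γ₂ t) ≤ δ) ∨
      (∃ t ∈ Set.Icc (0 : ℝ) (dist z x), dist (γ₁ s) (γ₃ t) ≤ δ)

end MetricDefs

section GroupDefs

variable {G : Type*} [Group G]

/-- Word length of `g` with respect to a generating set `S`. -/
noncomputable def wlen (S : Set G) (g : G) : ℕ :=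
  sInf {n : ℕ | ∃ l : List G, l.length = n ∧ (∀ x ∈ l, x ∈ S) ∧ l.prod = g}

/-- `φ` is a quasimorphism with defect at most `D`. -/
def QuasimorphismWithDefect (φ : G → ℝ) (D : ℝ) : Prop :=
  ∀ a b : G, |φ (a * b) - φ a - φ b| ≤ D

/-- `φ` is homogeneous. -/
def HomogeneousQM (φ : G → ℝ) : Prop :=
  ∀ (g : G) (n : ℤ), φ (g ^ n) = (n : ℝ) * φ g

end GroupDefs

/-- `c` restricted to `[a,b]` is a `(2,4)`-quasigeodesic. -/
def QuasiGeodesic24 {Y : Type*} [MetricSpace Y] (c : ℝ → Y) (a b : ℝ) : Prop :=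
  ∀ s ∈ Set.Icc a b, ∀ t ∈ Set.Icc a b,
    (1 / 2) * |s - t| - 4 ≤ dist (c s) (c t) ∧ dist (c s) (c t) ≤ 2 * |s - t| + 4

/-- The oriented subsegments `γ|[a₁,b₁]` and `γ|[a₂,b₂]` are `K` anti-aligned: some `g ∈ G`
takes the terminal point of the first within `K` of the initial point of the second and
vice versa. -/
def AntiAligned (G : Type*) [Group G] {Y : Type*} [MetricSpace Y] [MulAction G Y]
    (K : ℝ) (γ : ℝ → Y) (a₁ b₁ a₂ b₂ : ℝ) : Prop :=
  ∃ g : G, dist (g • γ b₁) (γ a₂) ≤ K ∧ dist (g • γ a₁) (γ b₂) ≤ K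

section Helpers

/-- Chains of points whose `R`-steps get a discount of `1`. -/
inductive Reach {Y : Type*} [MetricSpace Y] (R : Y → Y → Prop) (x : Y) : Y → ℝ → Prop
  | refl : Reach R x x 0
  | step {y : Y} {r : ℝ} (z : Y) : Reach R x y r → Reach R x z (r + dist y z)
  | wstep {y : Y} {r : ℝ} (z : Y) : Reach R x y r → R y z → Reach R x z (r + (dist y z - 1))

/-- Infimal cost of a chain. -/
noncomputable def rho {Y : Type*} [MetricSpace Y] (R : Y → Y → Prop) (x y : Y) : ℝ :=
  sInf {r | Reach R x y r}

variable {Y : Type*} [MetricSpace Y] {R : Y → Y → Prop} {L : ℝ}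

lemma Reach.lower (hL : 2 ≤ L) (hR : ∀ u v, R u v → dist u v = L) {x y : Y} {r : ℝ}
    (h : Reach R x y r) : (1 - 1 / L) * dist x y ≤ r := by
  have hL0 : 0 < L := by linarith
  have h1 : 1 / L ≤ 1 := by rw [div_le_one hL0]; linarith
  have h0 : 0 < 1 / L := by positivity
  have hLL : 1 / L * L = 1 := by field_simp
  induction h with
  | refl => simp
  | @step y r z h ih =>
    have := dist_triangle x y z
    have h2 : (0 : ℝ) ≤ dist y z := dist_nonneg
    nlinarith [mul_le_mul_of_nonneg_left this (sub_nonneg.2 h1), mul_nonneg h0.le h2]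
  | @wstep y r z h hr ih =>
    have := dist_triangle x y z
    have h2 := hR _ _ hr
    nlinarith [mul_le_mul_of_nonneg_left this (sub_nonneg.2 h1)]

lemma Reach.trans {x y z : Y} {r q : ℝ} (h : Reach R x y r) (h' : Reach R y z q) :
    Reach R x z (r + q) := by
  induction h' with
  | refl => simpa using h
  | step z _ ih => rw [← add_assoc]; exact ih.step z
  | wstep z _ hr ih => rw [← add_assoc]; exact ih.wstep z hr

lemma reach_dist (R : Y → Y → Prop) (x y : Y) : Reach R x y (dist x y) := by
  simpa using (Reach.refl (R := R) (x := x)).step y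

lemma Reach.nonneg (hL : 2 ≤ L) (hR : ∀ u v, R u v → dist u v = L) {x y : Y} {r : ℝ}
    (h : Reach R x y r) : 0 ≤ r := by
  refine le_trans ?_ (h.lower hL hR)
  have hL0 : 0 < L := by linarith
  have h1 : 1 / L ≤ 1 := by rw [div_le_one hL0]; linarith
  exact mul_nonneg (by linarith) dist_nonneg

lemma rho_le (hL : 2 ≤ L) (hR : ∀ u v, R u v → dist u v = L) {x y : Y} {r : ℝ}
    (h : Reach R x y r) : rho R x y ≤ r :=
  csInf_le ⟨0, fun _ hr => Reach.nonneg hL hR hr⟩ h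

lemma rho_le_dist (hL : 2 ≤ L) (hR : ∀ u v, R u v → dist u v = L) (x y : Y) :
    rho R x y ≤ dist x y := rho_le hL hR (reach_dist R x y)

lemma le_rho {x y : Y} {b : ℝ} (h : ∀ r, Reach R x y r → b ≤ r) : b ≤ rho R x y :=
  le_csInf ⟨_, reach_dist R x y⟩ h

lemma exists_reach (R : Y → Y → Prop) (x y : Y) {η : ℝ} (hη : 0 < η) :
    ∃ r, Reach R x y r ∧ r < rho R x y + η :=
  exists_lt_of_csInf_lt (s := {r | Reach R x y r}) ⟨_, reach_dist R x y⟩ (by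
    show rho R x y < _
    linarith)

lemma rho_triangle (hL : 2 ≤ L) (hR : ∀ u v, R u v → dist u v = L) (x y z : Y) :
    rho R x z ≤ rho R x y + rho R y z := by
  refine le_of_forall_pos_le_add fun η hη => ?_
  obtain ⟨r, hr, hr'⟩ := exists_reach R x y (half_pos hη)
  obtain ⟨q, hq, hq'⟩ := exists_reach R y z (half_pos hη)
  have := rho_le hL hR (hr.trans hq)
  linarith

lemma rho_step (hL : 2 ≤ L) (hR : ∀ u v, R u v → dist u v = L) {y z : Y} (h : R y z) :
    rho R y z ≤ dist y z - 1 := by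
  have := rho_le hL hR ((Reach.refl (R := R) (x := y)).wstep z h)
  linarith

lemma rho_lower (hL : 2 ≤ L) (hR : ∀ u v, R u v → dist u v = L) (x y : Y) :
    dist x y - dist x y / L ≤ rho R x y := by
  refine le_rho fun r hr => ?_
  have := hr.lower hL hR
  have h2 : (1 - 1 / L) * dist x y = dist x y - dist x y / L := by ring
  linarith

/-- The path traced by a chain. -/
lemma Reach.path (hg : GeodesicSpace Y) (hL : 2 ≤ L) (hR : ∀ u v, R u v → dist u v = L)
    {x y : Y} {r : ℝ} (h : Reach R x y r) :
    ∃ (T : ℝ) (c : ℝ → Y), 0 ≤ T ∧ c 0 = x ∧ c T = y ∧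
      (∀ s ∈ Set.Icc 0 T, ∀ t ∈ Set.Icc 0 T, dist (c s) (c t) ≤ |s - t|) ∧
      (∀ s ∈ Set.Icc 0 T, ∀ t ∈ Set.Icc 0 T, s ≤ t →
        rho R x (c s) + (t - s) / 2 - 2 + rho R (c t) y ≤ r) ∧
      (∀ s ∈ Set.Icc 0 T, rho R x (c s) + (T - s) / 2 - 1 ≤ r) ∧
      (dist x y ≤ r ∨ ∃ s ∈ Set.Icc 0 T, ∃ t ∈ Set.Icc 0 T, s ≤ t ∧ R (c s) (c t)) := by
  have key : ∀ (y z : Y) (r q : ℝ), Reach R x y r →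
      (dist y z ≤ q ∨ (R y z ∧ q = dist y z - 1)) → rho R y z ≤ q →
      (∃ (T : ℝ) (c : ℝ → Y), 0 ≤ T ∧ c 0 = x ∧ c T = y ∧
      (∀ s ∈ Set.Icc 0 T, ∀ t ∈ Set.Icc 0 T, dist (c s) (c t) ≤ |s - t|) ∧
      (∀ s ∈ Set.Icc 0 T, ∀ t ∈ Set.Icc 0 T, s ≤ t →
        rho R x (c s) + (t - s) / 2 - 2 + rho R (c t) y ≤ r) ∧
      (∀ s ∈ Set.Icc 0 T, rho R x (c s) + (T - s) / 2 - 1 ≤ r) ∧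
      (dist x y ≤ r ∨ ∃ s ∈ Set.Icc 0 T, ∃ t ∈ Set.Icc 0 T, s ≤ t ∧ R (c s) (c t))) →
      ∃ (T : ℝ) (c : ℝ → Y), 0 ≤ T ∧ c 0 = x ∧ c T = z ∧
      (∀ s ∈ Set.Icc 0 T, ∀ t ∈ Set.Icc 0 T, dist (c s) (c t) ≤ |s - t|) ∧
      (∀ s ∈ Set.Icc 0 T, ∀ t ∈ Set.Icc 0 T, s ≤ t →
        rho R x (c s) + (t - s) / 2 - 2 + rho R (c t) z ≤ r + q) ∧
      (∀ s ∈ Set.Icc 0 T, rho R x (c s) + (T - s) / 2 - 1 ≤ r + q) ∧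
      (dist x z ≤ r + q ∨ ∃ s ∈ Set.Icc 0 T, ∃ t ∈ Set.Icc 0 T, s ≤ t ∧ R (c s) (c t)) := by
    rintro y z r q hreach hq hρq ⟨T, c, hT, hc0, hcT, hlip, hI1, hI2, hI3⟩
    obtain ⟨γ, hγ0, hγ1, hγ⟩ := hg y z
    have hℓ : 0 ≤ dist y z := dist_nonneg
    set ℓ := dist y z with hℓdef
    have hqℓ : ℓ - 1 ≤ q ∧ ℓ / 2 ≤ q := by
      rcases hq with h | ⟨h, h'⟩
      · constructor <;> linarith
      · have := hR _ _ h
        constructor <;> linarith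
    set c' : ℝ → Y := fun s => if s ≤ T then c s else γ (s - T) with hc'
    have e1 : ∀ s, s ≤ T → c' s = c s := fun s hs => by simp [hc', hs]
    have e2 : ∀ s, T ≤ s → c' s = γ (s - T) := fun s hs => by
      rcases hs.eq_or_lt with rfl | hs
      · simp [hc', hcT, hγ0]
      · simp [hc', not_le.2 hs]
    have d2 : ∀ s t, T ≤ s → s ≤ T + ℓ → T ≤ t → t ≤ T + ℓ → dist (c' s) (c' t) = |s - t| := by
      intro s t h1 h2 h3 h4
      rw [e2 s h1, e2 t h3, hγ _ ⟨by linarith, by linarith⟩ _ ⟨by linarith, by linarith⟩]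
      congr 1; ring
    have eT : c' T = y := by rw [e1 T le_rfl, hcT]
    have eTz : c' (T + ℓ) = z := by rw [e2 _ (by linarith)]; simpa using hγ1
    have ry : rho R x y ≤ r := rho_le hL hR hreach
    have rs : ∀ s, T ≤ s → s ≤ T + ℓ → rho R x (c' s) ≤ r + (s - T) := by
      intro s h1 h2
      have a1 := rho_triangle hL hR x y (c' s)
      have a2 := rho_le_dist hL hR y (c' s)
      have a3 := d2 T s le_rfl (by linarith) h1 h2
      rw [eT, abs_of_nonpos (by linarith)] at a3
      linarith
    have rt : ∀ s, T ≤ s → s ≤ T + ℓ → rho R (c' s) z ≤ T + ℓ - s := by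
      intro s h1 h2
      have a2 := rho_le_dist hL hR (c' s) z
      have a3 := d2 s (T + ℓ) h1 h2 (by linarith) le_rfl
      rw [eTz, abs_of_nonpos (by linarith)] at a3
      linarith
    have lip : ∀ s ∈ Set.Icc 0 (T + ℓ), ∀ t ∈ Set.Icc 0 (T + ℓ), s ≤ t →
        dist (c' s) (c' t) ≤ t - s := by
      rintro s ⟨hs0, hs1⟩ t ⟨ht0, ht1⟩ hst
      rcases le_total t T with ht | ht
      · rw [e1 s (by linarith), e1 t ht]
        have := hlip s ⟨hs0, by linarith⟩ t ⟨ht0, ht⟩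
        rwa [abs_of_nonpos (by linarith), neg_sub] at this
      · rcases le_total s T with hs | hs
        · have a1 := hlip s ⟨hs0, hs⟩ T ⟨hT, le_rfl⟩
          rw [← e1 s hs, ← e1 T le_rfl, abs_of_nonpos (by linarith)] at a1
          have a2 := d2 T t le_rfl (by linarith) ht ht1
          rw [abs_of_nonpos (by linarith)] at a2
          have := dist_triangle (c' s) (c' T) (c' t)
          linarith
        · rw [d2 s t hs hs1 ht ht1, abs_of_nonpos (by linarith)]; linarith
    refine ⟨T + ℓ, c', by linarith, by rw [e1 0 hT, hc0], eTz, ?_, ?_, ?_, ?_⟩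
    · intro s hs t ht
      rcases le_total s t with hst | hst
      · rw [abs_of_nonpos (by linarith), neg_sub]; exact lip s hs t ht hst
      · rw [abs_of_nonneg (by linarith), dist_comm]; exact lip t ht s hs hst
    · rintro s ⟨hs0, hs1⟩ t ⟨ht0, ht1⟩ hst
      rcases le_total t T with ht | ht
      · rw [e1 s (by linarith), e1 t ht]
        have a1 := hI1 s ⟨hs0, by linarith⟩ t ⟨ht0, ht⟩ hst
        have a2 := rho_triangle hL hR (c t) y z
        linarith
      · rcases le_total s T with hs | hs
        · have a1 := hI2 s ⟨hs0, hs⟩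
          rw [← e1 s hs] at a1
          have a2 := rt t ht ht1
          linarith [hqℓ.1]
        · have a1 := rs s hs hs1
          have a2 := rt t ht ht1
          linarith [hqℓ.1]
    · rintro s ⟨hs0, hs1⟩
      rcases le_total s T with hs | hs
      · have a1 := hI2 s ⟨hs0, hs⟩
        rw [← e1 s hs] at a1
        linarith [hqℓ.2]
      · have a1 := rs s hs hs1
        linarith [hqℓ.1]
    · rcases hI3 with h | ⟨s, hs, t, ht, hst, h⟩
      · rcases hq with h' | ⟨h', -⟩
        · left
          have := dist_triangle x y z
          linarith
        · right
          refine ⟨T, ⟨hT, by linarith⟩, T + ℓ, ⟨by linarith, le_rfl⟩, by linarith, ?_⟩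
          rwa [eT, eTz]
      · right
        refine ⟨s, ⟨hs.1, by linarith [hs.2]⟩, t, ⟨ht.1, by linarith [ht.2]⟩, hst, ?_⟩
        rwa [e1 s hs.2, e1 t ht.2]
  induction h with
  | refl =>
    have hx := rho_le_dist hL hR x x
    rw [dist_self] at hx
    refine ⟨0, fun _ => x, le_rfl, rfl, rfl, ?_, ?_, ?_, ?_⟩
    · intro s _ t _; simp
    · rintro s ⟨h1, h2⟩ t ⟨h3, h4⟩ _; linarith
    · rintro s ⟨h1, h2⟩; linarith
    · left; simp
  | @step y r z h ih => exact key y z r _ h (Or.inl le_rfl) (rho_le_dist hL hR y z) ih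
  | @wstep y r z h hr ih => exact key y z r _ h (Or.inr ⟨hr, rfl⟩) (rho_step hL hR hr) ih

/-- The Morse property with constant `K`. -/
def Morse (Y : Type*) [MetricSpace Y] (K : ℝ) : Prop :=
  ∀ (c : ℝ → Y) (a b : ℝ), a ≤ b → QuasiGeodesic24 c a b →
          ∀ γ : ℝ → Y, GeodesicFromTo γ (c a) (c b) →
          ∀ s ∈ Set.Icc a b,
            ∃ t ∈ Set.Icc (0 : ℝ) (dist (c a) (c b)), dist (c s) (γ t) ≤ K

lemma Reach.qpath (hg : GeodesicSpace Y) (hL : 2 ≤ L) (hR : ∀ u v, R u v → dist u v = L)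
    {x y : Y} {r : ℝ} (h : Reach R x y r) (hr : r < rho R x y + 1) :
    ∃ (T : ℝ) (c : ℝ → Y), 0 ≤ T ∧ c 0 = x ∧ c T = y ∧
      (∀ s ∈ Set.Icc 0 T, ∀ t ∈ Set.Icc 0 T, dist (c s) (c t) ≤ |s - t|) ∧
      QuasiGeodesic24 c 0 T ∧
      (∀ s ∈ Set.Icc 0 T, rho R x (c s) + rho R (c s) y ≤ rho R x y + 3) ∧
      (dist x y ≤ r ∨ ∃ s ∈ Set.Icc 0 T, ∃ t ∈ Set.Icc 0 T, s ≤ t ∧ R (c s) (c t)) := by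
  obtain ⟨T, c, hT, h0, h1, hlip, hI1, hI2, hI3⟩ := h.path hg hL hR
  have low : ∀ s ∈ Set.Icc 0 T, ∀ t ∈ Set.Icc 0 T, s ≤ t →
      (t - s) / 2 - 4 ≤ dist (c s) (c t) := by
    intro s hs t ht hst
    have a1 := hI1 s hs t ht hst
    have a2 := rho_triangle hL hR x (c s) y
    have a3 := rho_triangle hL hR (c s) (c t) y
    have a4 := rho_le_dist hL hR (c s) (c t)
    linarith
  refine ⟨T, c, hT, h0, h1, hlip, ?_, ?_, hI3⟩
  · intro s hs t ht
    have a := hlip s hs t ht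
    refine ⟨?_, by linarith [abs_nonneg (s - t)]⟩
    rcases le_total s t with hst | hst
    · have := low s hs t ht hst
      rw [abs_of_nonpos (by linarith)]; linarith
    · have := low t ht s hs hst
      rw [dist_comm] at this
      rw [abs_of_nonneg (by linarith)]; linarith
  · intro s hs
    have a1 := hI1 s hs s hs le_rfl
    linarith

lemma rho_between (hg : GeodesicSpace Y) {δ K : ℝ} (hyp : GromovHyperbolic Y δ)
    (hδ : 0 ≤ δ) (hK : Morse Y K)
    (hL : 2 ≤ L) (hR : ∀ u v, R u v → dist u v = L)
    (x y o : Y) (ho : dist x o + dist o y ≤ dist x y + 2 * δ) :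
    rho R x o + rho R o y ≤ rho R x y + (3 + 8 * δ + 4 * K) := by
  obtain ⟨r, hr, hr'⟩ := exists_reach R x y one_pos
  obtain ⟨T, c, hT, h0, h1, hlip, hqg, hb, -⟩ := hr.qpath hg hL hR hr'
  obtain ⟨γ, hγ⟩ := hg x y
  obtain ⟨γ₂, hγ₂⟩ := hg y o
  obtain ⟨γ₃, hγ₃⟩ := hg o x
  have hxo : (0:ℝ) ≤ dist x o := dist_nonneg
  have hoy : (0:ℝ) ≤ dist o y := dist_nonneg
  have hxy : (0:ℝ) ≤ dist x y := dist_nonneg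
  set ρ := min (dist x o) (dist x y) with hρ
  have hρ0 : 0 ≤ ρ := le_min hxo hxy
  have hρ1 : ρ ≤ dist x y := min_le_right _ _
  have hρ2 : ρ ≤ dist x o := min_le_left _ _
  have hρ3 : dist x o - 2 * δ ≤ ρ := le_min (by linarith) (by linarith)
  have hxm : dist x (γ ρ) = ρ := by
    have := hγ.2.2 0 ⟨le_rfl, hxy⟩ ρ ⟨hρ0, hρ1⟩
    rw [hγ.1] at this
    rw [this, abs_of_nonpos (by linarith)]; ring
  have hym : dist y (γ ρ) = dist x y - ρ := by
    have := hγ.2.2 _ ⟨hxy, le_rfl⟩ ρ ⟨hρ0, hρ1⟩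
    rw [hγ.2.1] at this
    rw [this, abs_of_nonneg (by linarith)]
  have hmo : dist (γ ρ) o ≤ 4 * δ := by
    rcases hyp x y o γ γ₂ γ₃ hγ hγ₂ hγ₃ ρ ⟨hρ0, hρ1⟩ with ⟨t, ht, htd⟩ | ⟨t, ht, htd⟩
    · have a1 := hγ₂.2.2 0 ⟨le_rfl, ht.1.trans ht.2⟩ t ht
      have a2 := hγ₂.2.2 t ht _ ⟨ht.1.trans ht.2, le_rfl⟩
      rw [hγ₂.1, abs_of_nonpos (by linarith [ht.1])] at a1
      rw [hγ₂.2.1, abs_of_nonpos (by linarith [ht.2])] at a2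
      have a3 := dist_triangle y (γ₂ t) (γ ρ)
      have a4 := dist_triangle (γ ρ) (γ₂ t) o
      rw [dist_comm (γ₂ t) (γ ρ)] at a3
      rw [dist_comm y o] at a2
      linarith
    · have a1 := hγ₃.2.2 0 ⟨le_rfl, ht.1.trans ht.2⟩ t ht
      have a2 := hγ₃.2.2 t ht _ ⟨ht.1.trans ht.2, le_rfl⟩
      rw [hγ₃.1, abs_of_nonpos (by linarith [ht.1])] at a1
      rw [hγ₃.2.1, abs_of_nonpos (by linarith [ht.2])] at a2
      have a3 := dist_triangle x (γ₃ t) (γ ρ)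
      have a4 := dist_triangle (γ ρ) (γ₃ t) o
      rw [dist_comm (γ₃ t) (γ ρ), dist_comm x (γ₃ t)] at a3
      rw [dist_comm (γ₃ t) o] at a4
      rw [dist_comm o x] at a2
      linarith
  have hcont : ContinuousOn (fun s => dist x (c s)) (Set.Icc 0 T) := by
    have : LipschitzOnWith 1 c (Set.Icc 0 T) := by
      refine LipschitzOnWith.of_dist_le_mul fun s hs t ht => ?_
      simpa [Real.dist_eq] using hlip s hs t ht
    exact (continuous_const.dist continuous_id).comp_continuousOn this.continuousOn
  have hmem : ρ ∈ Set.Icc (dist x (c 0)) (dist x (c T)) := by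
    rw [h0, h1, dist_self]; exact ⟨hρ0, hρ1⟩
  obtain ⟨s, hs, hsρ⟩ := intermediate_value_Icc hT hcont hmem
  have hγ' : GeodesicFromTo γ (c 0) (c T) := by rwa [h0, h1]
  obtain ⟨t, ht, htd⟩ := hK c 0 T hT hqg γ hγ' s hs
  rw [h0, h1] at ht
  have hxt : dist x (γ t) = t := by
    have := hγ.2.2 0 ⟨le_rfl, hxy⟩ t ht
    rw [hγ.1] at this
    rw [this, abs_of_nonpos (by linarith [ht.1])]; ring
  have htρ : dist (γ t) (γ ρ) ≤ K := by
    rw [hγ.2.2 t ht ρ ⟨hρ0, hρ1⟩]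
    have b1 := dist_triangle x (γ t) (c s)
    have b2 := dist_triangle x (c s) (γ t)
    rw [dist_comm (γ t)] at b1
    simp only at hsρ
    rw [abs_le]; constructor <;> linarith
  have hco : dist (c s) o ≤ 4 * δ + 2 * K := by
    have b1 := dist_triangle4 (c s) (γ t) (γ ρ) o
    linarith
  have f1 := hb s hs
  have f2 := rho_triangle hL hR x (c s) o
  have f3 := rho_triangle hL hR o (c s) y
  have f4 := rho_le_dist hL hR (c s) o
  have f5 := rho_le_dist hL hR o (c s)
  rw [dist_comm o (c s)] at f5
  linarith

lemma exists_center (hg : GeodesicSpace Y) {δ : ℝ} (hyp : GromovHyperbolic Y δ)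
    (hδ : 0 ≤ δ) (x y z : Y) :
    ∃ o, dist x o + dist o y ≤ dist x y + 2 * δ ∧ dist y o + dist o z ≤ dist y z + 2 * δ ∧
      dist z o + dist o x ≤ dist z x + 2 * δ := by
  obtain ⟨γ, hγ⟩ := hg x y
  obtain ⟨γ₂, hγ₂⟩ := hg y z
  obtain ⟨γ₃, hγ₃⟩ := hg z x
  have t1 := dist_triangle x y z
  have t2 := dist_triangle y z x
  have t3 := dist_triangle z x y
  rw [dist_comm x z] at t1
  rw [dist_comm y x] at t2
  rw [dist_comm z y] at t3
  set ρ := (dist x y + dist z x - dist y z) / 2 with hρ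
  have hρ0 : 0 ≤ ρ := by linarith
  have hρ1 : ρ ≤ dist x y := by linarith
  have hxm : dist x (γ ρ) = ρ := by
    have := hγ.2.2 0 ⟨le_rfl, dist_nonneg⟩ ρ ⟨hρ0, hρ1⟩
    rw [hγ.1] at this
    rw [this, abs_of_nonpos (by linarith)]; ring
  have hym : dist y (γ ρ) = dist x y - ρ := by
    have := hγ.2.2 _ ⟨dist_nonneg, le_rfl⟩ ρ ⟨hρ0, hρ1⟩
    rw [hγ.2.1] at this
    rw [this, abs_of_nonneg (by linarith)]
  refine ⟨γ ρ, ?_⟩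
  rw [dist_comm (γ ρ) y, dist_comm (γ ρ) x, dist_comm z (γ ρ)]
  rcases hyp x y z γ γ₂ γ₃ hγ hγ₂ hγ₃ ρ ⟨hρ0, hρ1⟩ with ⟨t, ht, htd⟩ | ⟨t, ht, htd⟩
  · have a1 := hγ₂.2.2 0 ⟨le_rfl, ht.1.trans ht.2⟩ t ht
    have a2 := hγ₂.2.2 t ht _ ⟨ht.1.trans ht.2, le_rfl⟩
    rw [hγ₂.1, abs_of_nonpos (by linarith [ht.1])] at a1
    rw [hγ₂.2.1, abs_of_nonpos (by linarith [ht.2])] at a2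
    have a3 := dist_triangle y (γ₂ t) (γ ρ)
    have a4 := dist_triangle (γ ρ) (γ₂ t) z
    rw [dist_comm (γ₂ t) (γ ρ)] at a3
    refine ⟨?_, ?_, ?_⟩ <;> linarith
  · have a1 := hγ₃.2.2 0 ⟨le_rfl, ht.1.trans ht.2⟩ t ht
    have a2 := hγ₃.2.2 t ht _ ⟨ht.1.trans ht.2, le_rfl⟩
    rw [hγ₃.1, abs_of_nonpos (by linarith [ht.1])] at a1
    rw [hγ₃.2.1, abs_of_nonpos (by linarith [ht.2])] at a2
    have a3 := dist_triangle x (γ₃ t) (γ ρ)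
    have a4 := dist_triangle (γ ρ) (γ₃ t) z
    rw [dist_comm (γ₃ t) (γ ρ), dist_comm x (γ₃ t)] at a3
    rw [dist_comm (γ₃ t) z] at a4
    refine ⟨?_, ?_, ?_⟩ <;> linarith

/-- The antisymmetrized cost. -/
noncomputable def theta (R : Y → Y → Prop) (x y : Y) : ℝ := rho R y x - rho R x y

lemma theta_triangle (hg : GeodesicSpace Y) {δ K : ℝ} (hyp : GromovHyperbolic Y δ)
    (hδ : 0 ≤ δ) (hK : Morse Y K)
    (hL : 2 ≤ L) (hR : ∀ u v, R u v → dist u v = L) (x y z : Y) :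
    |theta R x z - theta R x y - theta R y z| ≤ 3 * (3 + 8 * δ + 4 * K) := by
  obtain ⟨o, h1, h2, h3⟩ := exists_center hg hyp hδ x y z
  have sw : ∀ a b : Y, dist a o + dist o b ≤ dist a b + 2 * δ →
      dist b o + dist o a ≤ dist b a + 2 * δ := by
    intro a b h
    rw [dist_comm b o, dist_comm o a, dist_comm b a]; linarith
  have b := rho_between (R := R) hg hyp hδ hK hL hR
  have b1 := b x y o h1
  have b2 := b y z o h2
  have b3 := b z x o h3
  have b4 := b y x o (sw _ _ h1)
  have b5 := b z y o (sw _ _ h2)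
  have b6 := b x z o (sw _ _ h3)
  have t := rho_triangle hL hR
  have t1 := t x o y
  have t2 := t y o z
  have t3 := t z o x
  have t4 := t y o x
  have t5 := t z o y
  have t6 := t x o z
  unfold theta
  rw [abs_le]; constructor <;> linarith

lemma abs_theta_le (hL : 2 ≤ L) (hR : ∀ u v, R u v → dist u v = L) (x y : Y) :
    |theta R x y| ≤ dist x y / L := by
  have a1 := rho_lower hL hR x y
  have a2 := rho_lower hL hR y x
  have a3 := rho_le_dist hL hR x y
  have a4 := rho_le_dist hL hR y x
  rw [dist_comm y x] at a2 a4
  unfold theta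
  rw [abs_le]; constructor <;> linarith

lemma rho_smul {G : Type*} [Group G] [MulAction G Y]
    (hiso : ∀ g : G, Isometry (fun y : Y => g • y))
    (hinv : ∀ (g : G) u v, R u v → R (g • u) (g • v)) (g : G) (x y : Y) :
    rho R (g • x) (g • y) = rho R x y := by
  have one : ∀ (g : G) (x y : Y) r, Reach R x y r → Reach R (g • x) (g • y) r := by
    intro g x y r h
    have hd : ∀ a b : Y, dist (g • a) (g • b) = dist a b := fun a b => (hiso g).dist_eq a b
    induction h with
    | refl => exact Reach.refl
    | @step y r z h ih => rw [← hd y z]; exact ih.step _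
    | @wstep y r z h hr ih => rw [← hd y z]; exact ih.wstep _ (hinv g _ _ hr)
  unfold rho
  congr 1
  ext r
  refine ⟨fun h => ?_, one g x y r⟩
  simpa using one g⁻¹ _ _ r h

open Filter Topology in
lemma exists_homog {G : Type*} [Group G] (f : G → ℝ) (D : ℝ)
    (hD : QuasimorphismWithDefect f D) (hinv : ∀ a, f a⁻¹ = - f a) :
    ∃ φ : G → ℝ, HomogeneousQM φ ∧ (∀ a, |φ a - f a| ≤ D) ∧
      ∀ a, Tendsto (fun k : ℕ => f (a ^ k) / k) atTop (𝓝 (φ a)) := by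
  have f1 : f 1 = 0 := by have := hinv 1; simp at this; linarith
  have hD0 : 0 ≤ D := (abs_nonneg _).trans (hD 1 1)
  have pw : ∀ a, ∀ k : ℕ, |f (a ^ k) - k * f a| ≤ k * D := by
    intro a k
    induction k with
    | zero => simp [f1]
    | succ k ih =>
      have h := hD (a ^ k) a
      rw [← pow_succ] at h
      rw [abs_le] at *
      push_cast
      constructor <;> linarith
  have ex : ∀ a, ∃ l, Tendsto (fun k : ℕ => f (a ^ k) / k) atTop (𝓝 l) := by
    intro a
    have hs : Subadditive (fun k : ℕ => f (a ^ k) + D) := by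
      intro m n
      have h := hD (a ^ m) (a ^ n)
      rw [← pow_add, abs_le] at h
      simp only
      linarith
    have hb : BddBelow (Set.range fun k : ℕ => (f (a ^ k) + D) / k) := by
      refine ⟨-|f a| - D, ?_⟩
      rintro _ ⟨k, rfl⟩
      rcases Nat.eq_zero_or_pos k with rfl | hk
      · simp only [Nat.cast_zero, div_zero]
        linarith [abs_nonneg (f a)]
      · have hk' : (0 : ℝ) < k := by exact_mod_cast hk
        have h := (abs_le.1 (pw a k)).1
        have h2 := neg_abs_le (f a)
        simp only
        rw [le_div_iff₀ hk']
        nlinarith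
    have ht := hs.tendsto_lim hb
    have h0 : Tendsto (fun k : ℕ => D / (k : ℝ)) atTop (𝓝 0) :=
      tendsto_const_div_atTop_nhds_zero_nat D
    refine ⟨hs.lim, ?_⟩
    have := ht.sub h0
    rw [sub_zero] at this
    refine this.congr fun k => ?_
    ring
  choose φ hφ using ex
  have hnat : ∀ a, ∀ n : ℕ, φ (a ^ n) = n * φ a := by
    intro a n
    rcases Nat.eq_zero_or_pos n with rfl | hn
    · refine tendsto_nhds_unique (hφ _) ?_
      simp [f1]
    · refine tendsto_nhds_unique (hφ _) ?_
      have h1 : Tendsto (fun k : ℕ => n * k) atTop atTop := 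
        tendsto_id.const_mul_atTop' hn
      have h2 := ((hφ a).comp h1).const_mul (n : ℝ)
      refine h2.congr fun k => ?_
      have : (n : ℝ) ≠ 0 := by positivity
      simp only [Function.comp, pow_mul, Nat.cast_mul]
      field_simp
  have hneg : ∀ a, φ a⁻¹ = - φ a := by
    intro a
    refine tendsto_nhds_unique (hφ _) ((hφ a).neg.congr fun k => ?_)
    rw [inv_pow, hinv]; ring
  refine ⟨φ, ?_, ?_, hφ⟩
  · intro a n
    obtain ⟨m, rfl | rfl⟩ := n.eq_nat_or_neg
    · simp [hnat]
    · simp [hnat, hneg]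
  · intro a
    have h1 := ((hφ a).sub_const (f a)).abs
    refine le_of_tendsto h1 ?_
    filter_upwards [eventually_gt_atTop 0] with k hk
    have hk' : (0 : ℝ) < k := by exact_mod_cast hk
    have h2 := pw a k
    have h3 : f (a ^ k) / k - f a = (f (a ^ k) - k * f a) / k := by field_simp
    rw [h3, abs_div, abs_of_pos hk', div_le_iff₀ hk']
    linarith

lemma exists_wlen_list {G : Type*} [Group G] {S : Set G} (hS : S⁻¹ = S)
    (hgen : Subgroup.closure S = ⊤) (h : G) :
    ∃ l : List G, l.length = wlen S h ∧ (∀ x ∈ l, x ∈ S) ∧ l.prod = h := by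
  have hne : {n : ℕ | ∃ l : List G, l.length = n ∧ (∀ x ∈ l, x ∈ S) ∧ l.prod = h}.Nonempty := by
    have hm : h ∈ Submonoid.closure (S ∪ S⁻¹) := by
      rw [← Subgroup.closure_toSubmonoid, hgen]; trivial
    obtain ⟨l, hl, hp⟩ := Submonoid.exists_list_of_mem_closure hm
    refine ⟨l.length, l, rfl, fun x hx => ?_, hp⟩
    rcases hl x hx with h | h
    · exact h
    · rw [← hS]; exact h
  exact Nat.sInf_mem hne

lemma dist_list_le {G : Type*} [Group G] [MulAction G Y]
    (hiso : ∀ g : G, Isometry (fun y : Y => g • y)) (p : Y) {S : Set G} {M : ℝ}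
    (hM : ∀ s ∈ S, dist p (s • p) ≤ M) (l : List G) (hl : ∀ x ∈ l, x ∈ S) :
    dist p (l.prod • p) ≤ l.length * M := by
  induction l with
  | nil => simp
  | cons a l ih =>
    have h1 := ih fun x hx => hl x (by simp [hx])
    have h2 := hM a (hl a (by simp))
    have h3 := dist_triangle p (a • p) ((a * l.prod) • p)
    have h4 : dist (a • p) ((a * l.prod) • p) = dist p (l.prod • p) := by
      rw [mul_smul]; exact (hiso a).dist_eq _ _
    simp only [List.prod_cons, List.length_cons]
    push_cast
    linarith

open Filter Topology in
lemma asymp {C₁ ε : ℝ} (hC₁ : 0 < C₁) (hε : 0 < ε) (K D : ℝ) :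
    ∃ n₀ : ℕ, ∀ n : ℕ, n₀ ≤ n → 2 ≤ C₁ * Real.log n ∧ 5 * K < C₁ * Real.log n ∧
      1 / (2 * C₁) * n / Real.log n ≤ n / (C₁ * Real.log n) - 1 - (n : ℝ) ^ (1 - ε) - D := by
  have key : ∀ᶠ x : ℝ in atTop, 2 ≤ C₁ * Real.log x ∧ 5 * K < C₁ * Real.log x ∧
      1 / (2 * C₁) * x / Real.log x ≤ x / (C₁ * Real.log x) - 1 - x ^ (1 - ε) - D := by
    have hlog : Tendsto (fun x => C₁ * Real.log x) atTop atTop :=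
      Real.tendsto_log_atTop.const_mul_atTop hC₁
    have o1 := (isLittleO_log_rpow_atTop hε).bound (c := 1 / (4 * C₁)) (by positivity)
    have o2 := (Real.isLittleO_log_id_atTop).bound (c := 1 / (4 * C₁ * (1 + |D|))) (by positivity)
    filter_upwards [hlog.eventually_ge_atTop 2, hlog.eventually_gt_atTop (5 * K), o1, o2,
      eventually_gt_atTop 1] with x h1 h2 h3 h4 h5
    refine ⟨h1, h2, ?_⟩
    have hx : 0 < x := by linarith
    have hl : 0 < Real.log x := Real.log_pos h5
    have hxe : 0 < x ^ ε := Real.rpow_pos_of_pos hx _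
    rw [Real.norm_of_nonneg hl.le, Real.norm_of_nonneg hxe.le] at h3
    rw [Real.norm_of_nonneg hl.le, id, Real.norm_of_nonneg hx.le] at h4
    have e1 : x ^ (1 - ε) ≤ x / (4 * C₁ * Real.log x) := by
      rw [Real.rpow_sub hx, Real.rpow_one, div_le_div_iff_of_pos_left hx hxe (by positivity)]
      rw [one_div, ← div_eq_inv_mul, le_div_iff₀ (by positivity)] at h3
      linarith
    have e2 : 1 + |D| ≤ x / (4 * C₁ * Real.log x) := by
      rw [le_div_iff₀ (by positivity)]
      have hd : 0 < 4 * C₁ * (1 + |D|) := by positivity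
      rw [one_div, ← div_eq_inv_mul, le_div_iff₀ hd] at h4
      linarith
    have e3 := le_abs_self D
    have e4 : x / (C₁ * Real.log x) = 4 * (x / (4 * C₁ * Real.log x)) := by field_simp
    have e5 : 1 / (2 * C₁) * x / Real.log x = 2 * (x / (4 * C₁ * Real.log x)) := by
      field_simp; norm_num
    rw [e4, e5]
    linarith
  obtain ⟨n₀, h⟩ := eventually_atTop.1 (tendsto_natCast_atTop_atTop.eventually key)
  exact ⟨n₀, h⟩

end Helpers

theorem lower_bound_template (δ C₁ ε K : ℝ) (hδ : 0 ≤ δ) (hC₁ : 0 < C₁) (hε : 0 < ε)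
    (hK : 0 ≤ K) :
    ∃ C₂ > (0 : ℝ), ∃ C₃ : ℝ,
      ∀ (G : Type u) (Y : Type v) [Group G] [MetricSpace Y] [MulAction G Y],
        (∀ g : G, Isometry (fun y : Y => g • y)) →
        GeodesicSpace Y → GromovHyperbolic Y δ →
        -- `K = K(δ)`: every (2,4)-quasigeodesic is in the `K`-neighborhood of any
        -- geodesic with the same endpoints
        (∀ (c : ℝ → Y) (a b : ℝ), a ≤ b → QuasiGeodesic24 c a b →
          ∀ γ : ℝ → Y, GeodesicFromTo γ (c a) (c b) →
          ∀ s ∈ Set.Icc a b,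
            ∃ t ∈ Set.Icc (0 : ℝ) (dist (c a) (c b)), dist (c s) (γ t) ≤ K) →
        ∀ S : Set G, S.Finite → S⁻¹ = S → Subgroup.closure S = ⊤ →
        ∀ p : Y,
        ∃ C₄ : ℝ, ∃ n₀ : ℕ, ∀ n : ℕ, n₀ ≤ n → ∀ g : G, ∀ γ : ℝ → Y,
          GeodesicFromTo γ p (g • p) → dist p (g • p) = n →
          ((Nat.card {i : ℕ //
              ((i : ℝ) + 1) * (C₁ * Real.log n) ≤ (n : ℝ) ∧
              ∃ a b : ℝ, 0 ≤ a ∧ a ≤ b ∧ b ≤ (n : ℝ) ∧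
                AntiAligned G K γ ((i : ℝ) * (C₁ * Real.log n))
                  (((i : ℝ) + 1) * (C₁ * Real.log n)) a b} : ℝ) < (n : ℝ) ^ (1 - ε)) →
          ∃ φ : G → ℝ, HomogeneousQM φ ∧ QuasimorphismWithDefect φ C₃ ∧
            C₂ * n / Real.log n ≤ φ g ∧
            ∀ h : G, |φ h| ≤ 2 * (wlen S h : ℝ) * C₄ / Real.log n := by
  classical
  set D : ℝ := 3 * (3 + 8 * δ + 4 * K) with hDdef
  refine ⟨1 / (2 * C₁), by positivity, 4 * D, ?_⟩
  intro G Y _ _ _ hiso hg hyp hmorse S hSfin hSinv hSgen p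
  have hK' : Morse Y K := hmorse
  obtain ⟨M, hM⟩ : ∃ M : ℝ, ∀ s ∈ S, dist p (s • p) ≤ M := by
    obtain ⟨M, hM⟩ := (hSfin.image fun s => dist p (s • p)).bddAbove
    exact ⟨M, fun s hs => hM ⟨s, hs, rfl⟩⟩
  obtain ⟨n₀, hn₀⟩ := asymp hC₁ hε K D
  refine ⟨|M| / C₁, n₀, ?_⟩
  intro n hn g γ hγ hdist hcount
  obtain ⟨hL2, hL5, hfin⟩ := hn₀ n hn
  set L := C₁ * Real.log n with hLdef
  have hL0 : 0 < L := by linarith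
  have hlog : 0 < Real.log n := by
    by_contra h
    nlinarith
  obtain ⟨hγ0, hγ1, hγg⟩ := hγ
  rw [hdist] at hγ1 hγg
  -- the bad indices
  set bad : ℕ → Prop := fun i => ∃ a b : ℝ, 0 ≤ a ∧ a ≤ b ∧ b ≤ (n : ℝ) ∧
    AntiAligned G K γ ((i : ℝ) * L) (((i : ℝ) + 1) * L) a b with hbad
  set R : Y → Y → Prop := fun u v => ∃ (h : G) (i : ℕ), ((i : ℝ) + 1) * L ≤ n ∧ ¬ bad i ∧
    u = h • γ ((i : ℝ) * L) ∧ v = h • γ (((i : ℝ) + 1) * L) with hRdef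
  have hdg : ∀ (h : G) (a b : Y), dist (h • a) (h • b) = dist a b :=
    fun h a b => (hiso h).dist_eq a b
  have hR : ∀ u v, R u v → dist u v = L := by
    rintro u v ⟨h, i, hi, -, rfl, rfl⟩
    have hi0 : (0 : ℝ) ≤ (i : ℝ) * L := by positivity
    rw [hdg, hγg _ ⟨hi0, by linarith⟩ _ ⟨by linarith, hi⟩, abs_of_nonpos (by linarith)]
    ring
  have hinv : ∀ (h : G) u v, R u v → R (h • u) (h • v) := by
    rintro h u v ⟨h', i, hi, hb, rfl, rfl⟩
    exact ⟨h * h', i, hi, hb, by rw [mul_smul], by rw [mul_smul]⟩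
  set f : G → ℝ := fun a => theta R p (a • p) with hf
  have hth : ∀ (a : G) x y, theta R (a • x) (a • y) = theta R x y := by
    intro a x y
    simp only [theta, rho_smul hiso hinv]
  have hfD : QuasimorphismWithDefect f D := by
    intro a b
    have h1 := theta_triangle (R := R) hg hyp hδ hK' hL2 hR p (a • p) ((a * b) • p)
    rwa [mul_smul, hth, ← mul_smul] at h1
  have hfinv : ∀ a, f a⁻¹ = - f a := by
    intro a
    have h1 := hth a p (a⁻¹ • p)
    rw [smul_inv_smul] at h1
    show theta R p (a⁻¹ • p) = -theta R p (a • p)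
    rw [← h1]
    unfold theta
    ring
  obtain ⟨φ, hhom, hclose, hlim⟩ := exists_homog f D hfD hfinv
  refine ⟨φ, hhom, ?_, ?_, ?_⟩
  · intro a b
    have a1 := hclose (a * b)
    have a2 := hclose a
    have a3 := hclose b
    have a4 := hfD a b
    rw [abs_le] at *
    constructor <;> linarith
  · -- lower bound
    -- no discounts on the way back
    have hback : (n : ℝ) ≤ rho R (g • p) p := by
      obtain ⟨r, hr, hr'⟩ := exists_reach R (g • p) p one_pos
      have all : ∀ r, Reach R (g • p) p r → r < rho R (g • p) p + 1 → (n : ℝ) ≤ r := by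
        intro r hr hr'
        obtain ⟨T, c, hT, h0, h1, hlip, hqg, -, hcase⟩ := hr.qpath hg hL2 hR hr'
        rcases hcase with h | ⟨s, hs, t, ht, hst, h⟩
        · rwa [dist_comm, hdist] at h
        · exfalso
          have hgeo : GeodesicFromTo (fun t => γ (n - t)) (c 0) (c T) := by
            rw [h0, h1]
            refine ⟨by simpa using hγ1, by simp [dist_comm (g • p) p, hdist, hγ0], ?_⟩
            rw [dist_comm, hdist]
            rintro s ⟨hs0, hs1⟩ t ⟨ht0, ht1⟩
            rw [hγg _ ⟨by linarith, by linarith⟩ _ ⟨by linarith, by linarith⟩, abs_sub_comm]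
            congr 1; ring
          obtain ⟨s', hs', hds⟩ := hK' c 0 T hT hqg _ hgeo s hs
          obtain ⟨t', ht', hdt⟩ := hK' c 0 T hT hqg _ hgeo t ht
          rw [h0, h1, dist_comm, hdist] at hs' ht'
          have hLd := hR _ _ h
          have hpu : dist (γ (n - s')) p = n - s' := by
            rw [← hγ0, hγg _ ⟨by linarith [hs'.2], by linarith [hs'.1]⟩ _ ⟨le_rfl, by positivity⟩,
              sub_zero, abs_of_nonneg (by linarith [hs'.2])]
          have hpv : dist (γ (n - t')) p = n - t' := by
            rw [← hγ0, hγg _ ⟨by linarith [ht'.2], by linarith [ht'.1]⟩ _ ⟨le_rfl, by positivity⟩,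
              sub_zero, abs_of_nonneg (by linarith [ht'.2])]
          have hord : s' ≤ t' := by
            by_contra hlt
            push Not at hlt
            have hq' : QuasiGeodesic24 c s T := fun a ha b hb =>
              hqg a ⟨hs.1.trans ha.1, ha.2⟩ b ⟨hs.1.trans hb.1, hb.2⟩
            obtain ⟨σ, hσ⟩ := hg (c s) (c T)
            obtain ⟨q, hq, hdq⟩ := hK' c s T hs.2 hq' σ hσ t ⟨hst, ht.2⟩
            have b1 := hσ.2.2 q hq _ ⟨hq.1.trans hq.2, le_rfl⟩
            rw [hσ.2.1, abs_of_nonpos (by linarith [hq.2])] at b1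
            rw [h1] at b1 hq
            have b2 := dist_triangle (c t) (σ q) p
            have b3 := dist_triangle (γ (n - t')) (c t) p
            have b4 := dist_triangle (c s) (γ (n - s')) p
            rw [dist_comm (γ (n - t')) (c t)] at b3
            have b5 := dist_triangle4 (c s) (γ (n - s')) (γ (n - t')) (c t)
            have b6 : dist (γ (n - s')) (γ (n - t')) = s' - t' := by
              rw [hγg _ ⟨by linarith [hs'.2], by linarith [hs'.1]⟩ _
                ⟨by linarith [ht'.2], by linarith [ht'.1]⟩, abs_of_nonpos (by linarith)]
              ring
            rw [dist_comm (γ (n - t')) (c t)] at b5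
            linarith [hq.1]
          obtain ⟨h, i, hi, hnb, hu, hv⟩ := h
          refine hnb ⟨n - t', n - s', by linarith [ht'.2], by linarith, by linarith [hs'.1], h, ?_, ?_⟩
          · rw [← hv]; exact hdt
          · rw [← hu]; exact hds
      refine le_rho fun q hq => ?_
      by_cases hq' : q < rho R (g • p) p + 1
      · exact all q hq hq'
      · have := all r hr hr'
        linarith
    -- discounts on the way forward
    have hforw : ∀ m : ℕ, (m : ℝ) * L ≤ n →
        rho R p (γ (m * L)) ≤ m * L - (((Finset.range m).filter fun i => ¬ bad i).card : ℝ) := by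
      intro m
      induction m with
      | zero =>
        intro _
        have := rho_le_dist hL2 hR p p
        simpa [hγ0] using this
      | succ m ih =>
        intro hm
        push_cast at hm ⊢
        have hm' : (m : ℝ) * L ≤ n := by linarith
        have a1 := ih hm'
        have a2 := rho_triangle hL2 hR p (γ (m * L)) (γ ((m + 1) * L))
        have hm0 : (0 : ℝ) ≤ m * L := by positivity
        have a3 : dist (γ (m * L)) (γ ((m + 1) * L)) = L := by
          rw [hγg _ ⟨hm0, hm'⟩ _ ⟨by linarith, hm⟩, abs_of_nonpos (by linarith)]; ring
        rw [Finset.range_add_one, Finset.filter_insert]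
        by_cases hb : bad m
        · rw [if_neg (not_not.2 hb)]
          have a4 := rho_le_dist hL2 hR (γ (m * L)) (γ ((m + 1) * L))
          linarith
        · rw [if_pos hb, Finset.card_insert_of_notMem (by simp)]
          have a5 : R (γ (m * L)) (γ ((m + 1) * L)) :=
            ⟨1, m, hm, hb, by rw [one_smul], by rw [one_smul]⟩
          have a4 := rho_step hL2 hR a5
          push_cast
          linarith
    set m := ⌊(n : ℝ) / L⌋₊ with hm
    have hnL : 0 ≤ (n : ℝ) / L := by positivity
    have hmL : (m : ℝ) * L ≤ n := by
      have := Nat.floor_le hnL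
      rwa [← hm, le_div_iff₀ hL0] at this
    have hm1 : (n : ℝ) / L < m + 1 := Nat.lt_floor_add_one _
    have hf1 := hforw m hmL
    have hf2 := rho_triangle hL2 hR p (γ (m * L)) (g • p)
    have hf3 := rho_le_dist hL2 hR (γ (m * L)) (g • p)
    have hm0 : (0 : ℝ) ≤ m * L := by positivity
    rw [← hγ1, hγg _ ⟨hm0, hmL⟩ _ ⟨by positivity, le_rfl⟩, hγ1, abs_of_nonpos (by linarith)] at hf3
    have hcard : Nat.card {i : ℕ // ((i : ℝ) + 1) * L ≤ n ∧ bad i} =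
        ((Finset.range m).filter fun i => bad i).card := by
      refine Nat.subtype_card _ fun i => ?_
      simp only [Finset.mem_filter, Finset.mem_range]
      refine and_congr_left fun _ => ?_
      rw [← le_div_iff₀ hL0, ← Nat.succ_le_iff, hm, Nat.le_floor_iff hnL]
      push_cast
      rfl
    have hcount' : (((Finset.range m).filter fun i => bad i).card : ℝ) < (n : ℝ) ^ (1 - ε) := by
      rw [← hcard]; exact hcount
    have hsum : (((Finset.range m).filter fun i => bad i).card : ℝ) +
        (((Finset.range m).filter fun i => ¬ bad i).card : ℝ) = m := by
      have := Finset.card_filter_add_card_filter_not (s := Finset.range m) bad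
      rw [Finset.card_range] at this
      exact_mod_cast this
    have hfg : f g = rho R (g • p) p - rho R p (g • p) := rfl
    have hcl := (abs_le.1 (hclose g)).1
    linarith
  · -- the word length bound
    intro h
    obtain ⟨l, hl, hlS, hlp⟩ := exists_wlen_list hSinv hSgen h
    have hM' : ∀ s ∈ S, dist p (s • p) ≤ |M| := fun s hs => (hM s hs).trans (le_abs_self M)
    have hd := dist_list_le hiso p hM' l hlS
    rw [hl, hlp] at hd
    have hpow : ∀ k : ℕ, dist p (h ^ k • p) ≤ k * dist p (h • p) := by
      intro k
      have := dist_list_le (S := {h}) (M := dist p (h • p)) hiso p (by simp) (List.replicate k h)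
        (fun x hx => List.eq_of_mem_replicate hx)
      simpa using this
    have hb : |φ h| ≤ dist p (h • p) / L := by
      refine le_of_tendsto (hlim h).abs ?_
      filter_upwards [Filter.eventually_gt_atTop 0] with k hk
      have hk' : (0 : ℝ) < k := by exact_mod_cast hk
      have a1 := abs_theta_le hL2 hR p (h ^ k • p)
      rw [abs_div, abs_of_pos hk', div_le_iff₀ hk']
      refine a1.trans ?_
      rw [div_mul_eq_mul_div]
      gcongr
      rw [mul_comm]; exact hpow k
    have e : 2 * (wlen S h : ℝ) * (|M| / C₁) / Real.log n = 2 * ((wlen S h * |M|) / L) := by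
      rw [hLdef]; field_simp
    rw [e]
    have h1 : dist p (h • p) / L ≤ (wlen S h * |M|) / L := by gcongr
    have h2 : 0 ≤ (wlen S h * |M|) / L := by positivity
    linarith

end SclPaper
end

section
/- Let Y be a δ-hyperbolic geodesic metric space, let p₀, p₁, …, p_n be a sequence of points in Y with d(p_i, p_{i+1}) ≤ C₁ for all i, and let γ be a geodesic from p₀ to p_n with length(γ) ≥ C₂·n, where C₂ > 0. Then for any ε > 0 there is a constant K depending only on ε, C₁, C₂ and δ such that, if γ_K denotes the set of points q on γ with d(q, p_i) ≤ K for some i, then length(γ_K)/length(γ) ≥ 1 − ε. -/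
/-!
STATEMENT 12 (Lemma `most_points_proximal`): for a walk with `C₁`-bounded increments in a
`δ`-hyperbolic geodesic space, if the geodesic `γ` joining the endpoints has length at
least `C₂·n`, then all but an `ε`-fraction of `γ` (in arclength measure) is `K`-proximal
to the walk, with `K` depending only on `ε, C₁, C₂, δ`.
-/

universe u

open MeasureTheory

namespace SclPaper

theorem key_step {Y : Type*} [MetricSpace Y] {δ R : ℝ} (hG : GeodesicSpace Y)
    (hH : GromovHyperbolic Y δ) (a b x y : Y) (γ : ℝ → Y) (hγ : GeodesicFromTo γ a b)
    (t : ℝ) (ht : t ∈ Set.Icc (0 : ℝ) (dist a b)) (hxy : dist x y ≤ R)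
    (hfar : R + 2 * δ < dist (γ t) x)
    (hx : dist x a - dist x b + dist a b < 2 * t - 2 * δ) :
    dist y a - dist y b + dist a b ≤ 2 * t + 4 * δ := by
  have geo : ∀ (c d : Y) (η : ℝ → Y), GeodesicFromTo η c d →
      ∀ s ∈ Set.Icc (0 : ℝ) (dist c d), dist c (η s) = s ∧ dist (η s) d = dist c d - s := by
    intro c d η ⟨h0, h1, h2⟩ s hs
    have hd : (0 : ℝ) ≤ dist c d := dist_nonneg
    constructor
    · have := h2 0 ⟨le_refl _, hd⟩ s hs
      rw [h0, zero_sub, abs_neg, abs_of_nonneg hs.1] at this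
      exact this
    · have := h2 s hs (dist c d) ⟨hd, le_refl _⟩
      rw [h1, abs_sub_comm, abs_of_nonneg (by linarith [hs.2])] at this
      exact this
  obtain ⟨g1, hg1⟩ := hG b x
  obtain ⟨g2, hg2⟩ := hG x a
  obtain ⟨g3, hg3⟩ := hG x y
  obtain ⟨g4, hg4⟩ := hG y b
  obtain ⟨e1, e2⟩ := geo _ _ _ hγ t ht
  rcases hH a b x γ g1 g2 hγ hg1 hg2 t ht with ⟨s, hs, h⟩ | ⟨s, hs, h⟩
  · rcases hH b x y g1 g3 g4 hg1 hg3 hg4 s hs with ⟨r, hr, h'⟩ | ⟨r, hr, h'⟩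
    · obtain ⟨k1, k2⟩ := geo _ _ _ hg3 r hr
      have := dist_triangle4 (γ t) (g1 s) (g3 r) x
      have := dist_comm x (g3 r)
      linarith [hr.2]
    · obtain ⟨k1, k2⟩ := geo _ _ _ hg4 r hr
      have t1 := dist_triangle (γ t) (g1 s) (g4 r)
      have t2 := dist_triangle y (g4 r) (γ t)
      have t3 := dist_triangle (γ t) (g4 r) b
      have t4 := dist_triangle y (γ t) a
      have := dist_comm (γ t) a
      have := dist_comm (γ t) (g4 r)
      linarith
  · obtain ⟨k1, k2⟩ := geo _ _ _ hg2 s hs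
    have t2 := dist_triangle x (g2 s) (γ t)
    have t3 := dist_triangle (γ t) (g2 s) a
    have t4 := dist_triangle x (γ t) b
    have := dist_comm (γ t) a
    have := dist_comm (γ t) (g2 s)
    linarith

theorem discrete_ivt (g : ℕ → ℝ) (t : ℝ) (k : ℕ) (h0 : g 0 ≤ t) (h1 : t ≤ g (k + 1)) :
    ∃ j ≤ k, g j ≤ t ∧ t ≤ g (j + 1) := by
  induction k with
  | zero => exact ⟨0, le_refl _, h0, h1⟩
  | succ k ih =>
    by_cases h : t ≤ g (k + 1)
    · obtain ⟨j, hj, h⟩ := ih h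
      exact ⟨j, by omega, h⟩
    · exact ⟨k + 1, le_refl _, le_of_not_ge h, h1⟩

theorem walk_dist {Y : Type*} [MetricSpace Y] {C : ℝ} (p : ℕ → Y) (n : ℕ)
    (hp : ∀ i < n, dist (p i) (p (i + 1)) ≤ C) (i k : ℕ) (h : i + k ≤ n) :
    dist (p i) (p (i + k)) ≤ k * C := by
  induction k with
  | zero => simp
  | succ k ih =>
    have h1 := ih (by omega)
    have h2 := hp (i + k) (by omega)
    have := dist_triangle (p i) (p (i + k)) (p (i + k + 1))
    rw [← add_assoc]
    push_cast
    linarith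

theorem most_points_proximal (δ C₁ C₂ : ℝ) (hδ : 0 ≤ δ) (hC₁ : 0 ≤ C₁) (hC₂ : 0 < C₂)
    (ε : ℝ) (hε : 0 < ε) :
    ∃ K : ℝ, ∀ (Y : Type u) [MetricSpace Y], GeodesicSpace Y → GromovHyperbolic Y δ →
      ∀ (n : ℕ) (p : ℕ → Y), (∀ i < n, dist (p i) (p (i + 1)) ≤ C₁) →
      ∀ γ : ℝ → Y, GeodesicFromTo γ (p 0) (p n) →
      C₂ * n ≤ dist (p 0) (p n) →
      (1 - ε) * dist (p 0) (p n) ≤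
        (volume {t ∈ Set.Icc (0 : ℝ) (dist (p 0) (p n)) |
            ∃ i ≤ n, dist (γ t) (p i) ≤ K}).toReal := by
  obtain ⟨N, hN⟩ := exists_nat_gt (8 * δ / (C₂ * ε))
  have hCe : 0 < C₂ * ε := mul_pos hC₂ hε
  have hNpos : (0 : ℝ) < N := lt_of_le_of_lt (by positivity) hN
  have hNp : 0 < N := by exact_mod_cast hNpos
  rw [div_lt_iff₀ hCe] at hN
  refine ⟨max (N * C₁ + 2 * δ) (16 * δ / ε), ?_⟩
  intro Y _ hG hH n p hp γ hγ hL
  set L := dist (p 0) (p n) with hLdef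
  set K := max (N * C₁ + 2 * δ) (16 * δ / ε) with hK
  have hL0 : 0 ≤ L := dist_nonneg
  set S := {t ∈ Set.Icc (0 : ℝ) L | ∃ i ≤ n, dist (γ t) (p i) ≤ K} with hS
  have hSsub : S ⊆ Set.Icc 0 L := fun t ht => ht.1
  have hSfin : volume S ≠ ⊤ := by
    refine ne_top_of_le_ne_top ?_ (measure_mono hSsub)
    simp
  by_cases hLK : L ≤ K
  · have : S = Set.Icc 0 L := by
      refine Set.Subset.antisymm hSsub fun t ht => ⟨ht, 0, Nat.zero_le _, ?_⟩
      have := hγ.2.2 t ht 0 ⟨le_refl _, hL0⟩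
      rw [hγ.1, sub_zero, abs_of_nonneg ht.1] at this
      linarith [ht.2]
    rw [this, Real.volume_Icc, ENNReal.toReal_ofReal (by linarith)]
    nlinarith
  push Not at hLK
  have hLbig : 16 * δ ≤ ε * L := by
    have : 16 * δ / ε ≤ L := le_trans (le_max_right _ _) hLK.le
    rw [div_le_iff₀ hε] at this
    linarith
  set q : ℕ → Y := fun j => p (min (j * N) n) with hq
  set f : Y → ℝ := fun x => (dist x (p 0) - dist x (p n) + L) / 2 with hf
  set m := n / N with hm
  have hq0 : q 0 = p 0 := by simp [hq]
  have hqm : q (m + 1) = p n := by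
    have : n ≤ (m + 1) * N := by
      have := Nat.lt_div_mul_add (a := n) hNp
      rw [add_mul, one_mul]; exact this.le
    simp only [hq, min_eq_right this]
  have hqd : ∀ j, dist (q j) (q (j + 1)) ≤ N * C₁ := by
    intro j
    have hle : min (j * N) n ≤ min ((j + 1) * N) n := by
      apply min_le_min_right; gcongr; omega
    obtain ⟨k, hk⟩ := Nat.exists_eq_add_of_le hle
    have hkN : k ≤ N := by
      have : (j + 1) * N = j * N + N := by ring
      omega
    have := walk_dist p n hp (min (j * N) n) k (by omega)
    simp only [hq]
    rw [hk]
    refine this.trans ?_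
    gcongr
  have hcover : Set.Icc 0 L ⊆ S ∪
      ⋃ j ∈ Finset.range (m + 2), Set.Icc (f (q j) - 2 * δ) (f (q j) + 2 * δ) := by
    intro t ht
    by_cases htS : t ∈ S
    · exact Or.inl htS
    right
    have hfar : ∀ i ≤ n, K < dist (γ t) (p i) := by
      intro i hi
      by_contra hcon
      exact htS ⟨ht, i, hi, le_of_not_gt hcon⟩
    obtain ⟨j, hj, h1, h2⟩ := discrete_ivt (fun j => f (q j)) t m
      (by simp only [hq0, hf, dist_self]; rw [← hLdef]; linarith [ht.1])
      (by simp only [hqm, hf, dist_self]; rw [dist_comm (p n), ← hLdef]; linarith [ht.2])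
    simp only [Set.mem_iUnion, Finset.mem_range, Set.mem_Icc]
    by_cases hx : f (q j) < t - δ
    · refine ⟨j + 1, by omega, ?_⟩
      have := key_step hG hH (p 0) (p n) (q j) (q (j + 1)) γ hγ t ht (hqd j)
        (lt_of_le_of_lt (le_max_left _ _) (hfar _ (min_le_right _ _)))
        (by simp only [hf] at hx; rw [← hLdef]; linarith)
      rw [← hLdef] at this
      have h3 : f (q (j + 1)) ≤ t + 2 * δ := by simp only [hf]; linarith
      constructor <;> linarith
    · refine ⟨j, by omega, ?_⟩
      push Not at hx
      constructor <;> linarith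
  have hvol : volume (⋃ j ∈ Finset.range (m + 2),
      Set.Icc (f (q j) - 2 * δ) (f (q j) + 2 * δ)) ≤ ENNReal.ofReal ((m + 2) * (4 * δ)) := by
    refine (measure_biUnion_finset_le _ _).trans ?_
    have : ∀ j, f (q j) + 2 * δ - (f (q j) - 2 * δ) = 4 * δ := fun j => by ring
    simp only [Real.volume_Icc, this, Finset.sum_const, Finset.card_range, nsmul_eq_mul]
    rw [show ((m : ℝ) + 2) = ((m + 2 : ℕ) : ℝ) by push_cast; rfl,
      ENNReal.ofReal_mul (Nat.cast_nonneg (m + 2)), ENNReal.ofReal_natCast]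
  have hmain : L ≤ (volume S).toReal + (m + 2) * (4 * δ) := by
    have h := (measure_mono hcover).trans ((measure_union_le _ _).trans (add_le_add_right hvol _))
    rw [Real.volume_Icc, sub_zero, ← ENNReal.ofReal_toReal hSfin,
      ← ENNReal.ofReal_add ENNReal.toReal_nonneg (by positivity)] at h
    exact (ENNReal.ofReal_le_ofReal_iff
      (add_nonneg ENNReal.toReal_nonneg (by positivity))).1 h
  have hmN : (m : ℝ) * N ≤ n := by exact_mod_cast Nat.div_mul_le_self n N
  have h8 : 8 * δ * m ≤ ε * L := by
    have a1 : 8 * δ * m ≤ N * (C₂ * ε) * m := by gcongr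
    have a2 : N * (C₂ * ε) * m = C₂ * ε * (m * N) := by ring
    have a3 : C₂ * ε * (m * N) ≤ C₂ * ε * n := by gcongr
    have a4 : ε * (C₂ * n) ≤ ε * L := by gcongr
    linarith
  linarith

end SclPaper
end

section
/- Let G be a finitely generated group acting by isometries on a δ-hyperbolic geodesic metric space Y with basepoint p, and let μ be a symmetric probability measure on G with finite support. Suppose there are constants L > 0, A > 1, a > 0 such that for all n, a random walk g_n of length n satisfies P( L·n/A ≤ d(p, g_n·p) ≤ L·A·n ) ≥ 1 − e^{−a·n} (linear progress with positive drift). Let p_i = g_i·p be the trajectory of the walk. Then there are constants C₁ > 0 and C₂ > 0 such that for every ε > 0 there is a constant K = K(ε) with the following property: for all n, with probability at least 1 − e^{−C₂·n}, any geodesic γ from p₀ to p_n satisfies length(γ) ≥ C₁·n and length(γ_K)/length(γ) ≥ 1 − ε, where γ_K is the set of K-proximal points of γ. -/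
/-!
STATEMENT 13 (Lemma `close_on_big_subset`): for a nondegenerate random walk on a group
acting on a `δ`-hyperbolic geodesic space with linear progress, with probability
`1 - e^{-C₂n}` any geodesic from `p₀` to `p_n` is long and mostly `K`-proximal to the walk.
-/

open scoped Classical BigOperators
open MeasureTheory

namespace SclPaper

/-- Position of the walk after `i` steps, for a step sequence `s`. -/
def walkPos {G : Type*} [Group G] {n : ℕ} (s : Fin n → G) (i : ℕ) : G :=
  ((List.ofFn s).take i).prod

/-- Probability, for the random walk of length `n` whose i.i.d. steps have law `μ`
(a probability measure supported in the finite set `T`), that the step sequence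
satisfies the event `E`. -/
noncomputable def walkProb {G : Type*} (μ : G → ℝ) (T : Finset G) (n : ℕ)
    (E : (Fin n → G) → Prop) : ℝ :=
  ∑ s : Fin n → {x // x ∈ T}, (∏ i, μ (s i : G)) *
    (if E (fun i => (s i : G)) then 1 else 0)

section Helpers

variable {Y : Type*} [MetricSpace Y]

lemma GeodesicFromTo.rev {γ : ℝ → Y} {x y : Y} (h : GeodesicFromTo γ x y) :
    GeodesicFromTo (fun t => γ (dist x y - t)) y x := by
  obtain ⟨h0, h1, h2⟩ := h
  refine ⟨by simpa using h1, by simp [dist_comm y x, h0], ?_⟩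
  intro s hs t ht
  rw [dist_comm y x] at hs ht
  have := h2 (dist x y - s) ⟨by linarith [hs.2], by linarith [hs.1]⟩
    (dist x y - t) ⟨by linarith [ht.2], by linarith [ht.1]⟩
  rw [this, ← abs_neg]
  congr 1
  ring

/-- `q` lies on a geodesic from `x` to `y`. -/
def OnGeo (q x y : Y) : Prop :=
  ∃ γ : ℝ → Y, GeodesicFromTo γ x y ∧ ∃ t ∈ Set.Icc (0 : ℝ) (dist x y), γ t = q

lemma OnGeo.symm {q x y : Y} (h : OnGeo q x y) : OnGeo q y x := by
  obtain ⟨γ, hγ, t, ht, rfl⟩ := h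
  refine ⟨_, hγ.rev, dist x y - t, ?_, by simp⟩
  rw [dist_comm y x]
  exact ⟨by linarith [ht.2], by linarith [ht.1]⟩

lemma OnGeo.dist_add {q x y : Y} (h : OnGeo q x y) : dist x q + dist q y = dist x y := by
  obtain ⟨γ, ⟨h0, h1, h2⟩, t, ht, rfl⟩ := h
  have a1 := h2 0 ⟨le_rfl, dist_nonneg⟩ t ht
  have a2 := h2 t ht (dist x y) ⟨dist_nonneg, le_rfl⟩
  rw [h0, abs_of_nonpos (by linarith [ht.1])] at a1
  rw [h1, abs_of_nonpos (by linarith [ht.2])] at a2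
  linarith

lemma thin {δ : ℝ} (hgeo : GeodesicSpace Y) (hhyp : GromovHyperbolic Y δ) {q x y : Y} (z : Y)
    (h : OnGeo q x y) :
    (∃ r, OnGeo r x z ∧ dist q r ≤ δ) ∨ (∃ r, OnGeo r z y ∧ dist q r ≤ δ) := by
  obtain ⟨γ, hγ, t, ht, rfl⟩ := h
  obtain ⟨γ₂, h₂⟩ := hgeo y z
  obtain ⟨γ₃, h₃⟩ := hgeo z x
  rcases hhyp x y z γ γ₂ γ₃ hγ h₂ h₃ t ht with ⟨u, hu, hd⟩ | ⟨u, hu, hd⟩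
  · exact Or.inr ⟨γ₂ u, OnGeo.symm ⟨γ₂, h₂, u, hu, rfl⟩, hd⟩
  · exact Or.inl ⟨γ₃ u, OnGeo.symm ⟨γ₃, h₃, u, hu, rfl⟩, hd⟩

lemma log_lemma {δ D : ℝ} (hgeo : GeodesicSpace Y) (hhyp : GromovHyperbolic Y δ)
    (hD : 0 ≤ D) (x : ℕ → Y)
    (hx : ∀ i, dist (x i) (x (i + 1)) ≤ D) (k : ℕ) :
    ∀ i j, i ≤ j → j ≤ i + 2 ^ k → ∀ q, OnGeo q (x i) (x j) →
      ∃ l, i ≤ l ∧ l ≤ j ∧ dist q (x l) ≤ k * δ + D := by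
  induction k with
  | zero =>
    intro i j hij hji q hq
    refine ⟨i, le_rfl, hij, ?_⟩
    have h1 := hq.dist_add
    have h2 : dist (x i) (x j) ≤ D := by
      rcases Nat.eq_or_lt_of_le hij with h | h
      · subst h; simpa using hD
      · have : j = i + 1 := by simp at hji; omega
        subst this; exact hx i
    rw [dist_comm q]
    have := dist_nonneg (x := q) (y := x j)
    simp; linarith
  | succ k ih =>
    intro i j hij hji q hq
    rw [pow_succ] at hji
    have key : ∃ m, i ≤ m ∧ m ≤ j ∧ m ≤ i + 2 ^ k ∧ j ≤ m + 2 ^ k :=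
      ⟨min j (i + 2 ^ k), by omega, by omega, by omega, by omega⟩
    obtain ⟨m, h1, h2, h3, h4⟩ := key
    push_cast
    rcases thin hgeo hhyp (x m) hq with ⟨r, hr, hd⟩ | ⟨r, hr, hd⟩
    · obtain ⟨l, l1, l2, l3⟩ := ih i m h1 h3 r hr
      exact ⟨l, l1, by omega, by linarith [dist_triangle q r (x l)]⟩
    · obtain ⟨l, l1, l2, l3⟩ := ih m j h2 h4 r hr
      exact ⟨l, by omega, l2, by linarith [dist_triangle q r (x l)]⟩

lemma proj_lemma {δ : ℝ} (hδ : 0 ≤ δ) (hgeo : GeodesicSpace Y) (hhyp : GromovHyperbolic Y δ)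
    {γ : ℝ → Y} {d : ℝ} (hγ : IsGeodesicOn γ 0 d) (v w : Y) (tv tw t : ℝ)
    (htv : tv ∈ Set.Icc 0 d) (htw : tw ∈ Set.Icc 0 d)
    (hv : ∀ u ∈ Set.Icc 0 d, dist v (γ tv) ≤ dist v (γ u))
    (hw : ∀ u ∈ Set.Icc 0 d, dist w (γ tw) ≤ dist w (γ u))
    (h1 : tv + 4 * δ < t) (h2 : t + 4 * δ < tw) :
    ∃ r, OnGeo r v w ∧ dist (γ t) r ≤ 2 * δ := by
  have ht : t ∈ Set.Icc 0 d := ⟨by linarith [htv.1], by linarith [htw.2]⟩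
  have hlen : dist (γ tv) (γ tw) = tw - tv := by
    rw [hγ tv htv tw htw, abs_of_nonpos (by linarith)]; ring
  have hq : OnGeo (γ t) (γ tv) (γ tw) := by
    refine ⟨fun u => γ (tv + u), ⟨by simp, by simp [hlen], ?_⟩, t - tv, ?_, by simp⟩
    · intro a ha b hb
      rw [hlen] at ha hb
      have := hγ (tv + a) ⟨by linarith [htv.1, ha.1], by linarith [htw.2, ha.2]⟩
        (tv + b) ⟨by linarith [htv.1, hb.1], by linarith [htw.2, hb.2]⟩
      simpa using this
    · rw [hlen]; exact ⟨by linarith, by linarith⟩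
  have far : ∀ (z : Y) (s : ℝ), s ∈ Set.Icc 0 d →
      (∀ u ∈ Set.Icc 0 d, dist z (γ s) ≤ dist z (γ u)) → ∀ r, OnGeo r z (γ s) →
      dist (γ t) r ≤ 2 * δ → |t - s| ≤ 4 * δ := by
    intro z s hs hz r hr hd
    rw [← hγ t ht s hs]
    have a1 := hr.dist_add
    have a2 := hz t ht
    have a3 := dist_triangle z r (γ t)
    have a4 := dist_triangle (γ t) r (γ s)
    rw [dist_comm r (γ t)] at a3
    linarith
  rcases thin hgeo hhyp w hq with ⟨r, hr, hd⟩ | ⟨r, hr, hd⟩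
  · rcases thin hgeo hhyp v hr with ⟨r', hr', hd'⟩ | ⟨r', hr', hd'⟩
    · have := far v tv htv hv r' hr'.symm (by linarith [dist_triangle (γ t) r r'])
      have := (abs_le.1 this).2
      linarith
    · exact ⟨r', hr', by linarith [dist_triangle (γ t) r r']⟩
  · have := far w tw htw hw r hr (by linarith)
    have := (abs_le.1 this).1
    linarith

lemma exists_proj {γ : ℝ → Y} {d : ℝ} (hd : 0 ≤ d) (hγ : IsGeodesicOn γ 0 d) (v : Y) :
    ∃ t ∈ Set.Icc 0 d, ∀ u ∈ Set.Icc 0 d, dist v (γ t) ≤ dist v (γ u) := by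
  have hc : ContinuousOn γ (Set.Icc 0 d) := by
    have : LipschitzOnWith 1 γ (Set.Icc 0 d) := by
      apply LipschitzOnWith.of_dist_le_mul
      intro a ha b hb
      rw [hγ a ha b hb, Real.dist_eq]; simp
    exact this.continuousOn
  exact isCompact_Icc.exists_isMinOn ⟨0, le_rfl, hd⟩
    ((continuous_const.dist continuous_id : Continuous fun y : Y => dist v y).comp_continuousOn hc)

lemma measure_bound {δ D : ℝ} (hδ : 0 ≤ δ) (hgeo : GeodesicSpace Y) (hhyp : GromovHyperbolic Y δ)
    (hD : 0 ≤ D) (x : ℕ → Y)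
    (hx : ∀ i, dist (x i) (x (i + 1)) ≤ D) (k n : ℕ) (K : ℝ) (hK : 2 * δ + k * δ + D ≤ K)
    (γ : ℝ → Y) (hγ : GeodesicFromTo γ (x 0) (x n)) :
    dist (x 0) (x n) - (n / 2 ^ k + 2) * (8 * δ) ≤
      (volume {t ∈ Set.Icc (0 : ℝ) (dist (x 0) (x n)) | ∃ i ≤ n, dist (γ t) (x i) ≤ K}).toReal := by
  set d := dist (x 0) (x n) with hd
  obtain ⟨g0, g1, g2⟩ := hγ
  have hd0 : 0 ≤ d := dist_nonneg
  set N := 2 ^ k with hN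
  have hNpos : 0 < N := by positivity
  set m := n / N + 1 with hm
  set b : ℕ → ℕ := fun j => min (j * N) n with hb
  choose τ hτ hτ' using fun j => exists_proj hd0 g2 (x (b j))
  have hb0 : b 0 = 0 := by simp [hb]
  have hbm : b m = n := by
    have : n < N * (n / N + 1) := Nat.lt_mul_div_succ n hNpos
    simp only [hb, hm]; rw [mul_comm]; exact min_eq_right this.le
  have hτm : τ m = d := by
    have := hτ' m d ⟨hd0, le_rfl⟩
    rw [hbm, g1, dist_self, ← g1, g2 d ⟨hd0, le_rfl⟩ _ (hτ m)] at this
    have := abs_nonpos_iff.1 this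
    linarith
  have hτ0 : τ 0 = 0 := by
    have := hτ' 0 0 ⟨le_rfl, hd0⟩
    rw [hb0, g0, dist_self, ← g0, g2 0 ⟨le_rfl, hd0⟩ _ (hτ 0)] at this
    have := abs_nonpos_iff.1 this
    linarith
  set B : Set ℝ := ⋃ j ∈ Finset.range (m + 1), Set.Icc (τ j - 4 * δ) (τ j + 4 * δ) with hB
  set S := {t ∈ Set.Icc (0 : ℝ) d | ∃ i ≤ n, dist (γ t) (x i) ≤ K} with hS
  have hsub : Set.Icc 0 d ⊆ S ∪ B := by
    intro t ht
    by_cases htB : t ∈ B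
    · exact Or.inr htB
    left
    refine ⟨ht, ?_⟩
    have hnb : ∀ j ≤ m, ¬ (τ j - 4 * δ ≤ t ∧ t ≤ τ j + 4 * δ) := by
      intro j hj hh
      apply htB
      simp only [hB, Set.mem_iUnion]
      exact ⟨j, Finset.mem_range.2 (by omega), hh⟩
    have hex : ∃ j, t ≤ τ j := ⟨m, by rw [hτm]; exact ht.2⟩
    have f1 := Nat.find_spec hex
    have f2 : Nat.find hex ≤ m := Nat.find_min' hex (by rw [hτm]; exact ht.2)
    rcases hj : Nat.find hex with _ | j
    · exfalso
      rw [hj, hτ0] at f1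
      apply hnb 0 (Nat.zero_le _)
      rw [hτ0]; constructor <;> linarith [ht.1]
    · have f3 := Nat.find_min hex (m := j) (by omega)
      rw [hj] at f1 f2
      push Not at f3
      have n1 := hnb j (by omega)
      have n2 := hnb (j + 1) f2
      obtain ⟨r, hr, hdr⟩ := proj_lemma hδ hgeo hhyp g2 (x (b j)) (x (b (j + 1))) (τ j) (τ (j + 1)) t
        (hτ _) (hτ _) (hτ' _) (hτ' _)
        (by by_contra h; exact n1 ⟨by linarith, by linarith⟩)
        (by by_contra h; exact n2 ⟨by linarith, by linarith⟩)
      have hmul : (j + 1) * N = j * N + N := by ring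
      obtain ⟨l, l1, l2, l3⟩ := log_lemma hgeo hhyp hD x hx k (b j) (b (j + 1))
        (by simp only [hb]; omega) (by simp only [hb]; omega) r hr
      refine ⟨l, ?_, ?_⟩
      · have : b (j + 1) ≤ n := min_le_right _ _
        omega
      · linarith [dist_triangle (γ t) r (x l)]
  have hBm : volume B ≤ ENNReal.ofReal ((m + 1) * (8 * δ)) := by
    calc volume B ≤ ∑ j ∈ Finset.range (m + 1), volume (Set.Icc (τ j - 4 * δ) (τ j + 4 * δ)) :=
          measure_biUnion_finset_le _ _
      _ = ∑ j ∈ Finset.range (m + 1), ENNReal.ofReal (8 * δ) := by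
          refine Finset.sum_congr rfl fun j _ => ?_
          rw [Real.volume_Icc]; congr 1; ring
      _ = ENNReal.ofReal ((m + 1) * (8 * δ)) := by
          rw [Finset.sum_const, Finset.card_range, nsmul_eq_mul, ← Nat.cast_succ,
            ENNReal.ofReal_mul (p := ((m.succ : ℕ) : ℝ)) (by positivity), ENNReal.ofReal_natCast]
  have hSfin : volume S ≠ ⊤ := by
    refine ne_top_of_le_ne_top ?_ (measure_mono (show S ⊆ Set.Icc 0 d from fun t ht => ht.1))
    rw [Real.volume_Icc]; exact ENNReal.ofReal_ne_top
  have htot : ENNReal.ofReal d ≤ volume S + ENNReal.ofReal ((m + 1) * (8 * δ)) := by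
    calc ENNReal.ofReal d = volume (Set.Icc 0 d) := by rw [Real.volume_Icc]; simp
      _ ≤ volume (S ∪ B) := measure_mono hsub
      _ ≤ volume S + volume B := measure_union_le _ _
      _ ≤ _ := by gcongr
  have hreal := ENNReal.toReal_mono (ENNReal.add_ne_top.2 ⟨hSfin, ENNReal.ofReal_ne_top⟩) htot
  rw [ENNReal.toReal_add hSfin ENNReal.ofReal_ne_top, ENNReal.toReal_ofReal hd0,
    ENNReal.toReal_ofReal (by positivity)] at hreal
  have hmn : (m : ℝ) + 1 ≤ n / 2 ^ k + 2 := by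
    have : ((n / N : ℕ) : ℝ) ≤ n / (N : ℝ) := Nat.cast_div_le
    rw [hm]; push_cast
    rw [hN] at this ⊢
    push_cast at this
    linarith
  have : ((m : ℝ) + 1) * (8 * δ) ≤ (n / 2 ^ k + 2) * (8 * δ) := by gcongr
  linarith

lemma dist_le_of_step {D : ℝ} (x : ℕ → Y) (hx : ∀ i, dist (x i) (x (i + 1)) ≤ D) (n : ℕ) :
    dist (x 0) (x n) ≤ n * D := by
  induction n with
  | zero => simp
  | succ n ih =>
    push_cast
    linarith [dist_triangle (x 0) (x n) (x (n + 1)), hx n]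

lemma path_lemma {δ D c ε : ℝ} (hδ : 0 ≤ δ) (hgeo : GeodesicSpace Y)
    (hhyp : GromovHyperbolic Y δ) (hD : 0 ≤ D) (hc : 0 < c) (hε : 0 < ε) :
    ∃ K : ℝ, ∀ (n : ℕ) (x : ℕ → Y), (∀ i, dist (x i) (x (i + 1)) ≤ D) →
      c * n ≤ dist (x 0) (x n) → ∀ γ : ℝ → Y, GeodesicFromTo γ (x 0) (x n) →
      (1 - ε) * dist (x 0) (x n) ≤ (volume {t ∈ Set.Icc (0 : ℝ) (dist (x 0) (x n)) |
        ∃ i ≤ n, dist (γ t) (x i) ≤ K}).toReal := by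
  have hec : 0 < ε * c := mul_pos hε hc
  obtain ⟨k, hk⟩ := pow_unbounded_of_one_lt (16 * δ / (ε * c)) (one_lt_two)
  obtain ⟨n0, hn0⟩ := exists_nat_gt (32 * δ / (ε * c))
  refine ⟨max (2 * δ + k * δ + D) (n0 * D), ?_⟩
  intro n x hx hlen γ hγ
  rcases le_or_gt n n0 with hn | hn
  · have hset : {t ∈ Set.Icc (0 : ℝ) (dist (x 0) (x n)) |
        ∃ i ≤ n, dist (γ t) (x i) ≤ max (2 * δ + k * δ + D) (n0 * D)} =
        Set.Icc (0 : ℝ) (dist (x 0) (x n)) := by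
      ext t
      refine ⟨fun h => h.1, fun h => ⟨h, 0, Nat.zero_le _, le_max_of_le_right ?_⟩⟩
      have h1 := OnGeo.dist_add ⟨γ, hγ, t, h, rfl⟩
      have h2 := dist_le_of_step x hx n
      have h3 : (n : ℝ) * D ≤ n0 * D := by gcongr
      rw [dist_comm]
      linarith [dist_nonneg (x := γ t) (y := x n)]
    rw [hset, Real.volume_Icc, ENNReal.toReal_ofReal (by simp)]
    nlinarith [dist_nonneg (x := x 0) (y := x n)]
  · refine le_trans ?_ (measure_bound hδ hgeo hhyp hD x hx k n _ (le_max_left _ _) γ hγ)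
    have hn' : (n0 : ℝ) < n := by exact_mod_cast hn
    have a1 : 32 * δ < n * (ε * c) := by
      rw [div_lt_iff₀ hec] at hn0
      exact hn0.trans (by gcongr)
    have hp : (0 : ℝ) < 2 ^ k := by positivity
    have a2 : 16 * δ / 2 ^ k ≤ ε * c := by
      rw [div_lt_iff₀ hec] at hk
      rw [div_le_iff₀ hp]; linarith
    have a3 : (n : ℝ) * (16 * δ / 2 ^ k) ≤ n * (ε * c) := by gcongr
    have a4 : ε * (c * n) ≤ ε * dist (x 0) (x n) := by gcongr
    have a5 : ((n : ℝ) / 2 ^ k + 2) * (8 * δ) = (n * (16 * δ / 2 ^ k)) / 2 + 16 * δ := by ring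
    rw [a5]
    linarith

lemma walk_step {G : Type*} [Group G] [MulAction G Y]
    (hiso : ∀ g : G, Isometry (fun y : Y => g • y)) (p : Y) {D : ℝ} (hD : 0 ≤ D) {n : ℕ}
    (s : Fin n → G) (hs : ∀ i, dist p (s i • p) ≤ D) (i : ℕ) :
    dist (walkPos s i • p) (walkPos s (i + 1) • p) ≤ D := by
  unfold walkPos
  by_cases hi : i < n
  · rw [List.prod_take_succ _ _ (by simpa using hi), mul_smul]
    rw [(hiso _).dist_eq]
    simpa using hs ⟨i, hi⟩
  · rw [List.take_of_length_le (by simp; omega), List.take_of_length_le (by simp; omega)]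
    simpa using hD

end Helpers

theorem close_on_big_subset
    {G : Type*} [Group G] {Y : Type*} [MetricSpace Y] [MulAction G Y]
    (δ : ℝ) (hδ : 0 ≤ δ)
    (hiso : ∀ g : G, Isometry (fun y : Y => g • y))
    (hgeo : GeodesicSpace Y) (hhyp : GromovHyperbolic Y δ)
    (p : Y) (hFG : Group.FG G)
    (μ : G → ℝ) (T : Finset G)
    (hμ0 : ∀ g, 0 ≤ μ g) (hμsupp : ∀ g, μ g ≠ 0 → g ∈ T) (hμsum : ∑ g ∈ T, μ g = 1)
    (hμsym : ∀ g, μ g⁻¹ = μ g)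
    (L A a : ℝ) (hL : 0 < L) (hA : 1 < A) (ha : 0 < a)
    (hprog : ∀ n : ℕ, 1 - Real.exp (-a * n) ≤ walkProb μ T n (fun s =>
        L * n / A ≤ dist p (walkPos s n • p) ∧ dist p (walkPos s n • p) ≤ L * A * n)) :
    ∃ C₁ > (0 : ℝ), ∃ C₂ > (0 : ℝ), ∀ ε : ℝ, 0 < ε → ∃ K : ℝ, ∀ n : ℕ,
      1 - Real.exp (-C₂ * n) ≤ walkProb μ T n (fun s =>
        ∀ γ : ℝ → Y, GeodesicFromTo γ p (walkPos s n • p) →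
          C₁ * n ≤ dist p (walkPos s n • p) ∧
          (1 - ε) * dist p (walkPos s n • p) ≤
            (volume {t ∈ Set.Icc (0 : ℝ) (dist p (walkPos s n • p)) |
                ∃ i ≤ n, dist (γ t) (walkPos s i • p) ≤ K}).toReal) := by
  obtain ⟨D, hD, hTD⟩ : ∃ D : ℝ, 0 ≤ D ∧ ∀ g ∈ T, dist p (g • p) ≤ D :=
    ⟨∑ g ∈ T, dist p (g • p), Finset.sum_nonneg fun _ _ => dist_nonneg, fun g hg =>
      Finset.single_le_sum (f := fun g => dist p (g • p)) (fun _ _ => dist_nonneg) hg⟩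
  have hc : 0 < L / A := div_pos hL (by linarith)
  refine ⟨L / A, hc, a, ha, fun ε hε => ?_⟩
  obtain ⟨K, hK⟩ := path_lemma (Y := Y) hδ hgeo hhyp hD hc hε
  refine ⟨K, fun n => (hprog n).trans ?_⟩
  unfold walkProb
  refine Finset.sum_le_sum fun s _ => ?_
  refine mul_le_mul_of_nonneg_left ?_ (Finset.prod_nonneg fun i _ => hμ0 _)
  split_ifs with h1 h2
  · exact le_rfl
  · exfalso
    apply h2
    intro γ hγ
    have hlen : L / A * n ≤ dist p (walkPos (fun i => (s i : G)) n • p) := by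
      have := h1.1
      rwa [mul_div_right_comm] at this
    refine ⟨hlen, ?_⟩
    have h0 : walkPos (fun i => (s i : G)) 0 • p = p := by simp [walkPos]
    have := hK n (fun i => walkPos (fun i => (s i : G)) i • p)
      (walk_step hiso p hD _ fun i => hTD _ (s i).2)
    simp only [h0] at this
    exact this hlen γ hγ
  · exact zero_le_one
  · exact le_rfl

end SclPaper
end

section
/- Let Ḡ be a subgroup of the group of orientation-preserving homeomorphisms of ℝ that commute with the translation x ↦ x + 1 (equivalently, of the group of units of the monoid of monotone degree-one lifts of circle maps), and let S̄ be a finite generating set of Ḡ. Define a random sequence g₀, g₁, g₂, … in Ḡ by g₀ = id and g_n = g_{n−1}·s_n, where s₁, s₂, … are independent and uniformly distributed on S̄. Let rot denote the Poincaré translation number, rot(h) = lim_{m→∞} h^m(0)/m. Then there exist constants E ∈ ℝ and σ ≥ 0 such that the distribution of (rot(g_n) − E·n)/√n converges weakly, as n → ∞, to the Gaussian measure N(0, σ²) on ℝ (interpreted as the Dirac mass at 0 when σ = 0). -/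
/-!
STATEMENT 19 (Central Limit Theorem for rotation number, Theorem `circle_clt`): for a
finitely generated subgroup `Ḡ` of the group of orientation-preserving homeomorphisms of
`ℝ` commuting with integer translation (the units of the monoid `CircleDeg1Lift`), and the
right random walk `g_n = s₁⋯s_n` with steps i.i.d. uniform on a finite generating set
`S̄`, there are constants `E` and `σ ≥ 0` such that the law of `(rot(g_n) - E·n)/√n`
converges weakly to the Gaussian measure `N(0, σ²)` (the Dirac mass at `0` if `σ = 0`).
Weak convergence is expressed by testing against bounded continuous functions, and the
expectation over the walk is the average over all `|S̄|ⁿ` step sequences.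
-/

open scoped Classical BigOperators

namespace SclPaper

/-- The value of the walk `g_n = s₁ s₂ ⋯ s_n` in a group `H`, for steps `s : Fin n → H`. -/
def walkEnd {H : Type*} [Group H] {n : ℕ} (s : Fin n → H) : H :=
  (List.ofFn s).prod

open Finset Filter Topology

section Expect

variable {α : Type*} [Fintype α]

lemma expect_cons {M : Type*} [AddCommMonoid M] [Module ℚ≥0 M] (n : ℕ)
    (F : (Fin (n + 1) → α) → M) :
    𝔼 s, F s = 𝔼 a : α, 𝔼 s : Fin n → α, F (Fin.cons a s) := by
  rw [← Finset.expect_product' Finset.univ Finset.univ (fun a s => F (Fin.cons a s))]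
  rw [Finset.univ_product_univ]
  exact (Fintype.expect_equiv (Fin.consEquiv (fun _ => α)) _ _ (fun x => rfl)).symm

lemma expect_append {M : Type*} [AddCommMonoid M] [Module ℚ≥0 M] (m n : ℕ)
    (F : (Fin (m + n) → α) → M) :
    𝔼 s, F s = 𝔼 a : Fin m → α, 𝔼 b : Fin n → α, F (Fin.append a b) := by
  rw [← Finset.expect_product' Finset.univ Finset.univ (fun a b => F (Fin.append a b))]
  rw [Finset.univ_product_univ]
  exact (Fintype.expect_equiv (Fin.appendEquiv m n) _ _ (fun x => rfl)).symm

/-- Regrouping `k * m` letters into `k` blocks of `m` letters. -/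
def blk (k m : ℕ) (b : Fin k → Fin m → α) : Fin (k * m) → α :=
  fun i => b (finProdFinEquiv.symm i).1 (finProdFinEquiv.symm i).2

lemma expect_blk {M : Type*} [AddCommMonoid M] [Module ℚ≥0 M] (k m : ℕ)
    (F : (Fin (k * m) → α) → M) :
    𝔼 s, F s = 𝔼 b : Fin k → Fin m → α, F (blk k m b) := by
  refine (Fintype.expect_equiv ((Equiv.curry (Fin k) (Fin m) α).symm.trans
    (Equiv.arrowCongr finProdFinEquiv (Equiv.refl α))) _ _ (fun x => ?_)).symm
  rfl

/-- Bias-variance identity. -/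
lemma bias_var [Nonempty α] (X : α → ℝ) (c : ℝ) :
    𝔼 a, (X a - c) ^ 2 = 𝔼 a, (X a - 𝔼 b, X b) ^ 2 + (𝔼 b, X b - c) ^ 2 := by
  set μ := 𝔼 b, X b with hμ
  have h1 : ∀ a, (X a - c) ^ 2 = (X a - μ) ^ 2 + (2 * (μ - c) * (X a - μ) + (μ - c) ^ 2) := by
    intro a; ring
  simp_rw [h1]
  rw [expect_add_distrib, expect_add_distrib, ← mul_expect, expect_sub_distrib,
    Fintype.expect_const, Fintype.expect_const, ← hμ]
  ring

lemma abs_expect_le_of [Nonempty α] (X : α → ℝ) (c : ℝ) (h : ∀ a, |X a| ≤ c) :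
    |𝔼 a, X a| ≤ c :=
  (abs_expect_le _ _).trans (expect_le univ_nonempty fun a _ => h a)

lemma expect_abs_le_sqrt [Nonempty α] (X : α → ℝ) :
    𝔼 a, |X a| ≤ √(𝔼 a, (X a) ^ 2) := by
  apply Real.le_sqrt_of_sq_le
  have h := bias_var (fun a => |X a|) 0
  have h2 : 0 ≤ 𝔼 a, (|X a| - 𝔼 b, |X b|) ^ 2 := expect_nonneg fun a _ => sq_nonneg _
  simp only [sub_zero, sq_abs] at h
  linarith

end Expect

section QM

variable {G : Type*} [Monoid G] {ι : Type*}

/-- Product of a word. -/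
def W (β : ι → G) (n : ℕ) (s : Fin n → ι) : G := (List.ofFn fun i => β (s i)).prod

lemma W_cons (β : ι → G) (n : ℕ) (a : ι) (s : Fin n → ι) :
    W β (n + 1) (Fin.cons a s) = β a * W β n s := by
  simp [W, List.ofFn_succ]

lemma W_append (β : ι → G) (m n : ℕ) (a : Fin m → ι) (b : Fin n → ι) :
    W β (m + n) (Fin.append a b) = W β m a * W β n b := by
  have : (fun i => β (Fin.append a b i)) = Fin.append (fun i => β (a i)) (fun i => β (b i)) := by
    funext i
    refine Fin.addCases (fun i => ?_) (fun i => ?_) i <;> simp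
  rw [W, this, List.ofFn_fin_append, List.prod_append]; rfl

lemma W_blk (β : ι → G) (k m : ℕ) (b : Fin k → Fin m → ι) :
    W β (k * m) (blk k m b) = W (W β m) k b := by
  rw [W, List.ofFn_mul, List.prod_flatten, List.map_ofFn, W]
  congr 2
  funext i
  simp only [Function.comp, W]
  congr 2
  funext j
  have : (⟨i * m + j, by
      calc
        (i : ℕ) * m + j < (i + 1) * m :=
          (Nat.add_lt_add_left j.prop _).trans_eq (by rw [Nat.add_mul, Nat.one_mul])
        _ ≤ _ := Nat.mul_le_mul_right _ i.prop⟩ : Fin (k * m)) = finProdFinEquiv (i, j) := by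
    ext; simp [finProdFinEquiv]; ring
  rw [this, blk]
  simp only [Equiv.symm_apply_apply]

variable [Fintype ι] [Nonempty ι]

lemma var_bound (φ : G → ℝ) (D : ℝ) (hq : ∀ g h, |φ (g * h) - φ g - φ h| ≤ D)
    (β : ι → G) (ψ : ι → ℝ) (K : ℝ) (hψ : ∀ a, |φ (β a) - ψ a| ≤ K) (k : ℕ) : ∀ g : G,
    𝔼 s : Fin k → ι, ((φ (g * W β k s) - ∑ i, ψ (s i)) -
      𝔼 s' : Fin k → ι, (φ (g * W β k s') - ∑ i, ψ (s' i))) ^ 2 ≤ (2 * D + K) ^ 2 * k := by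
  induction k with
  | zero =>
    intro g
    simp
  | succ k ih =>
    intro g
    set T : G → (Fin k → ι) → ℝ := fun g s => φ (g * W β k s) - ∑ i, ψ (s i) with hT
    set e : ι → ℝ := fun a => 𝔼 s, T (g * β a) s - ψ a with he
    have hTs : ∀ a s, (φ (g * W β (k + 1) (Fin.cons a s)) -
        ∑ i, ψ ((Fin.cons a s : Fin (k + 1) → ι) i)) = T (g * β a) s - ψ a := by
      intro a s
      rw [W_cons, Fin.sum_univ_succ, hT]
      simp only [Fin.cons_zero, Fin.cons_succ, mul_assoc]
      ring
    have hmean : 𝔼 s' : Fin (k + 1) → ι, (φ (g * W β (k + 1) s') - ∑ i, ψ (s' i)) = 𝔼 a, e a := by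
      rw [expect_cons]
      refine expect_congr rfl fun a _ => ?_
      simp_rw [hTs]
      rw [expect_sub_distrib, Fintype.expect_const]
    rw [hmean, expect_cons]
    simp_rw [hTs]
    have h1 : ∀ a, 𝔼 s, (T (g * β a) s - ψ a - 𝔼 a, e a) ^ 2 ≤
        (2 * D + K) ^ 2 * k + (e a - 𝔼 a, e a) ^ 2 := by
      intro a
      have := bias_var (T (g * β a)) (ψ a + 𝔼 a, e a)
      simp_rw [sub_sub]
      rw [this]
      have h2 := ih (g * β a)
      have h3 : (𝔼 b, T (g * β a) b - (ψ a + 𝔼 a, e a)) ^ 2 = (e a - 𝔼 a, e a) ^ 2 := by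
        simp only [he]; ring
      rw [h3]
      linarith
    have hc : ∀ a, |e a - (φ g + 𝔼 s : Fin k → ι, T 1 s)| ≤ 2 * D + K := by
      intro a
      have : e a - (φ g + 𝔼 s : Fin k → ι, T 1 s) =
          𝔼 s : Fin k → ι, (T (g * β a) s - T 1 s - (ψ a + φ g)) := by
        rw [expect_sub_distrib univ (fun s => T (g * β a) s - T 1 s) (fun _ => ψ a + φ g),
          expect_sub_distrib univ (T (g * β a)) (T 1), Fintype.expect_const]
        simp only [he]; ring
      rw [this]
      refine abs_expect_le_of _ _ fun s => ?_
      simp only [hT, one_mul]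
      have a1 := abs_le.1 (hq (g * β a) (W β k s))
      have a2 := abs_le.1 (hq g (β a))
      have a3 := abs_le.1 (hψ a)
      rw [abs_le]
      constructor <;> linarith
    calc _ ≤ 𝔼 a, ((2 * D + K) ^ 2 * k + (e a - 𝔼 a, e a) ^ 2) :=
          expect_le_expect fun a _ => h1 a
      _ = (2 * D + K) ^ 2 * k + 𝔼 a, (e a - 𝔼 a, e a) ^ 2 := by
          rw [expect_add_distrib, Fintype.expect_const]
      _ ≤ (2 * D + K) ^ 2 * k + 𝔼 a, (e a - (φ g + 𝔼 s : Fin k → ι, T 1 s)) ^ 2 := by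
          rw [bias_var e (φ g + 𝔼 s : Fin k → ι, T 1 s)]
          nlinarith [sq_nonneg (𝔼 a, e a - (φ g + 𝔼 s : Fin k → ι, T 1 s))]
      _ ≤ (2 * D + K) ^ 2 * k + (2 * D + K) ^ 2 := by
          gcongr
          refine expect_le univ_nonempty fun a _ => ?_
          exact sq_le_sq' (abs_le.1 (hc a)).1 (abs_le.1 (hc a)).2
      _ = _ := by push_cast; ring

/-- Mean of the quasimorphism along the walk. -/
noncomputable def mn (φ : G → ℝ) (β : ι → G) (n : ℕ) : ℝ := 𝔼 s : Fin n → ι, φ (W β n s)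

lemma mn_add (φ : G → ℝ) (D : ℝ) (hq : ∀ g h, |φ (g * h) - φ g - φ h| ≤ D)
    (β : ι → G) (m n : ℕ) : |mn φ β (m + n) - mn φ β m - mn φ β n| ≤ D := by
  have : mn φ β (m + n) - mn φ β m - mn φ β n =
      𝔼 a : Fin m → ι, 𝔼 b : Fin n → ι, (φ (W β m a * W β n b) - φ (W β m a) - φ (W β n b)) := by
    simp_rw [expect_sub_distrib, Fintype.expect_const]
    simp only [mn]
    rw [expect_append]
    simp_rw [W_append]
  rw [this]
  exact abs_expect_le_of _ _ fun a => abs_expect_le_of _ _ fun b => hq _ _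

lemma exists_drift (a : ℕ → ℝ) (D : ℝ) (h : ∀ m n, |a (m + n) - a m - a n| ≤ D) :
    ∃ E : ℝ, ∀ n, |a n - n * E| ≤ D := by
  have h0 : |a 0| ≤ D := by
    have := h 0 0
    simp only [add_zero, sub_self, zero_sub, abs_neg] at this
    exact this
  have hD : 0 ≤ D := (abs_nonneg _).trans h0
  have hmul : ∀ k n : ℕ, |a ((k + 1) * n) - (k + 1) * a n| ≤ k * D := by
    intro k n
    induction k with
    | zero => simp
    | succ k ih =>
      have h1 := abs_le.1 (h ((k + 1) * n) n)
      have h2 := abs_le.1 ih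
      have h3 : (k + 1 + 1) * n = (k + 1) * n + n := by ring
      rw [h3, abs_le]
      push_cast
      constructor <;> linarith
  have hmul' : ∀ k n : ℕ, 0 < k → |a (k * n) - k * a n| ≤ k * D := by
    intro k n hk
    obtain ⟨j, rfl⟩ := Nat.exists_eq_succ_of_ne_zero hk.ne'
    have := hmul j n
    push_cast
    refine this.trans ?_
    nlinarith
  have key : ∀ m n : ℕ, 0 < m → 0 < n → (a n - D) / n ≤ (a m + D) / m := by
    intro m n hm hn
    have hm' : (0 : ℝ) < m := by exact_mod_cast hm
    have hn' : (0 : ℝ) < n := by exact_mod_cast hn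
    rw [div_le_div_iff₀ hn' hm']
    have h1 := abs_le.1 (hmul' m n hm)
    have h2 := abs_le.1 (hmul' n m hn)
    rw [mul_comm n m] at h2
    linarith
  set S : Set ℝ := {x | ∃ n : ℕ, 0 < n ∧ x = (a n - D) / n} with hS
  have hSn : S.Nonempty := ⟨_, 1, one_pos, rfl⟩
  have hSb : BddAbove S := ⟨(a 1 + D) / (1 : ℕ), by
    rintro x ⟨n, hn, rfl⟩; exact key 1 n one_pos hn⟩
  refine ⟨sSup S, fun n => ?_⟩
  rcases Nat.eq_zero_or_pos n with rfl | hn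
  · simpa using h0
  have hn' : (0 : ℝ) < n := by exact_mod_cast hn
  have h1 : (a n - D) / n ≤ sSup S := le_csSup hSb ⟨n, hn, rfl⟩
  have h2 : sSup S ≤ (a n + D) / n := csSup_le hSn (by
    rintro x ⟨k, hk, rfl⟩; exact key n k hn hk)
  rw [div_le_iff₀ hn'] at h1
  rw [le_div_iff₀ hn'] at h2
  rw [abs_le]
  constructor <;> linarith

lemma W_bound (φ : G → ℝ) (D : ℝ) (hq : ∀ g h, |φ (g * h) - φ g - φ h| ≤ D)
    (β : ι → G) (K : ℝ) (hK : ∀ a, |φ (β a)| ≤ K) (n : ℕ) (s : Fin n → ι) :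
    |φ (W β n s)| ≤ D + n * (K + D) := by
  induction n with
  | zero =>
    have := hq 1 1
    simp only [mul_one, sub_self, zero_sub, abs_neg] at this
    simpa [W] using this
  | succ n ih =>
    rw [← Fin.cons_self_tail s, W_cons]
    have h1 := abs_le.1 (hq (β (s 0)) (W β n (Fin.tail s)))
    have h2 := abs_le.1 (ih (Fin.tail s))
    have h3 := abs_le.1 (hK (s 0))
    rw [abs_le]
    push_cast
    constructor <;> linarith

end QM

lemma exp_diff (x y : ℝ) : ‖Complex.exp (Complex.I * x) - Complex.exp (Complex.I * y)‖ ≤ |x - y| := by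
  have h : Complex.exp (Complex.I * x) - Complex.exp (Complex.I * y) =
      Complex.exp (Complex.I * y) * (Complex.exp (Complex.I * ((x - y : ℝ) : ℂ)) - 1) := by
    rw [mul_sub, ← Complex.exp_add]
    push_cast
    ring_nf
  rw [h, norm_mul, Complex.norm_exp_I_mul_ofReal, one_mul]
  exact Real.norm_exp_I_mul_ofReal_sub_one_le

lemma pow_diff (a b : ℂ) (ha : ‖a‖ ≤ 1) (hb : ‖b‖ ≤ 1) (k : ℕ) :
    ‖a ^ k - b ^ k‖ ≤ k * ‖a - b‖ := by
  induction k with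
  | zero => simp
  | succ k ih =>
    have h : a ^ (k + 1) - b ^ (k + 1) = a * (a ^ k - b ^ k) + (a - b) * b ^ k := by ring
    rw [h]
    refine (norm_add_le _ _).trans ?_
    rw [norm_mul, norm_mul, norm_pow]
    have h1 : ‖a‖ * ‖a ^ k - b ^ k‖ ≤ 1 * (k * ‖a - b‖) := by gcongr
    have h2 : ‖a - b‖ * ‖b‖ ^ k ≤ ‖a - b‖ * 1 := by
      gcongr; exact pow_le_one₀ (norm_nonneg _) hb
    push_cast
    linarith

section Char
variable {B : Type*} [Fintype B] [Nonempty B]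

lemma expect_coord (f : B → ℝ) (k : ℕ) (i : Fin k) : 𝔼 s : Fin k → B, f (s i) = 𝔼 b, f b := by
  induction k with
  | zero => exact i.elim0
  | succ k ih =>
    rw [expect_cons]
    refine Fin.cases ?_ (fun j => ?_) i
    · simp only [Fin.cons_zero, Fintype.expect_const]
    · simp only [Fin.cons_succ]
      rw [ih j, Fintype.expect_const]

lemma char_est (Y : B → ℝ) (h0 : 𝔼 b, Y b = 0) :
    ∃ C : ℝ, ∃ δ : ℝ, 0 < δ ∧ ∀ u : ℝ, |u| ≤ δ →
      ‖𝔼 b, Complex.exp (Complex.I * ((u * Y b : ℝ) : ℂ)) -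
        Complex.exp ((-((𝔼 b, (Y b) ^ 2) * u ^ 2 / 2) : ℝ) : ℂ)‖ ≤ C * |u| ^ 3 := by
  set V := 𝔼 b, (Y b) ^ 2 with hV
  obtain ⟨R, hR1, hR⟩ : ∃ R : ℝ, 1 ≤ R ∧ ∀ b, |Y b| ≤ R := by
    refine ⟨1 + ∑ b, |Y b|, ?_, fun b => ?_⟩
    · have : 0 ≤ ∑ b, |Y b| := sum_nonneg fun b _ => abs_nonneg _
      linarith
    · have : |Y b| ≤ ∑ b, |Y b| := single_le_sum (f := fun b => |Y b|)
        (fun b _ => abs_nonneg _) (mem_univ b)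
      linarith
  have hRp : 0 < R := by linarith
  have hV0 : 0 ≤ V := expect_nonneg fun b _ => sq_nonneg _
  have hVR : V ≤ R ^ 2 := expect_le univ_nonempty fun b _ => by
    rw [← sq_abs]; exact pow_le_pow_left₀ (abs_nonneg _) (hR b) 2
  refine ⟨2 * R ^ 3, 1 / R, by positivity, fun u hu => ?_⟩
  have huR : |u| * R ≤ 1 := by rwa [le_div_iff₀ hRp] at hu
  have huR0 : 0 ≤ |u| * R := by positivity
  have hmid : ((1 - V * u ^ 2 / 2 : ℝ) : ℂ) =
      𝔼 b, (1 + Complex.I * ((u * Y b : ℝ) : ℂ) + (Complex.I * ((u * Y b : ℝ) : ℂ)) ^ 2 / 2) := by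
    have e1 : ∀ b, (1 + Complex.I * ((u * Y b : ℝ) : ℂ) + (Complex.I * ((u * Y b : ℝ) : ℂ)) ^ 2 / 2)
        = 1 + (Complex.I * u) * ((Y b : ℝ) : ℂ) + (-(u : ℂ) ^ 2 / 2) * (((Y b) ^ 2 : ℝ) : ℂ) := by
      intro b
      push_cast
      rw [mul_pow, Complex.I_sq]; ring
    simp_rw [e1]
    rw [expect_add_distrib, expect_add_distrib, ← mul_expect, ← mul_expect, Fintype.expect_const]
    have e2 : 𝔼 b, ((Y b : ℝ) : ℂ) = ((𝔼 b, Y b : ℝ) : ℂ) := by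
      rw [Fintype.expect_eq_sum_div_card, Fintype.expect_eq_sum_div_card]; push_cast; rfl
    have e3 : 𝔼 b, (((Y b) ^ 2 : ℝ) : ℂ) = ((V : ℝ) : ℂ) := by
      rw [hV, Fintype.expect_eq_sum_div_card, Fintype.expect_eq_sum_div_card]; push_cast; rfl
    rw [e2, e3, h0]
    push_cast
    ring
  have hA : ‖𝔼 b, Complex.exp (Complex.I * ((u * Y b : ℝ) : ℂ)) - ((1 - V * u ^ 2 / 2 : ℝ) : ℂ)‖
      ≤ (|u| * R) ^ 3 := by
    rw [hmid, ← expect_sub_distrib]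
    refine (RCLike.norm_expect_le (K := ℂ)).trans (expect_le univ_nonempty fun b _ => ?_)
    have hn : ‖Complex.I * ((u * Y b : ℝ) : ℂ)‖ ≤ |u| * R := by
      rw [norm_mul, Complex.norm_I, one_mul, Complex.norm_real, Real.norm_eq_abs, abs_mul]
      gcongr; exact hR b
    have := Complex.exp_bound (hn.trans huR) (n := 3) (by norm_num)
    simp only [sum_range_succ, range_zero, sum_empty, pow_zero, Nat.factorial_zero, Nat.cast_one,
      div_one, zero_add, pow_one, Nat.factorial_one, Nat.factorial_two, Nat.cast_ofNat] at this
    refine this.trans ?_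
    have h3 : ‖Complex.I * ((u * Y b : ℝ) : ℂ)‖ ^ 3 ≤ (|u| * R) ^ 3 :=
      pow_le_pow_left₀ (norm_nonneg _) hn 3
    refine le_trans (mul_le_of_le_one_right (by positivity) ?_) h3
    norm_num [Nat.factorial]
  have hB : ‖((1 - V * u ^ 2 / 2 : ℝ) : ℂ) - Complex.exp ((-(V * u ^ 2 / 2) : ℝ) : ℂ)‖
      ≤ (|u| * R) ^ 3 := by
    rw [← Complex.ofReal_exp, ← Complex.ofReal_sub, Complex.norm_real, norm_sub_rev]
    have hx : V * u ^ 2 / 2 ≤ (|u| * R) ^ 2 := by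
      rw [mul_pow, sq_abs]
      nlinarith [mul_le_mul_of_nonneg_right hVR (sq_nonneg u), mul_nonneg hV0 (sq_nonneg u)]
    have hx0 : 0 ≤ V * u ^ 2 / 2 := by positivity
    have hsq : (|u| * R) ^ 2 ≤ 1 := pow_le_one₀ huR0 huR
    have hnx : ‖-(V * u ^ 2 / 2)‖ = V * u ^ 2 / 2 := by
      rw [norm_neg, Real.norm_of_nonneg hx0]
    have := Real.norm_exp_sub_one_sub_id_le (x := -(V * u ^ 2 / 2)) (by rw [hnx]; linarith)
    rw [hnx] at this
    have e : Real.exp (-(V * u ^ 2 / 2)) - 1 - -(V * u ^ 2 / 2) =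
      Real.exp (-(V * u ^ 2 / 2)) - (1 - V * u ^ 2 / 2) := by ring
    rw [e] at this
    refine this.trans ?_
    calc (V * u ^ 2 / 2) ^ 2 ≤ ((|u| * R) ^ 2) ^ 2 := by gcongr
      _ = (|u| * R) ^ 3 * (|u| * R) := by ring
      _ ≤ (|u| * R) ^ 3 * 1 := by gcongr
      _ = _ := mul_one _
  calc _ ≤ _ := norm_sub_le_norm_sub_add_norm_sub _ ((1 - V * u ^ 2 / 2 : ℝ) : ℂ) _
    _ ≤ (|u| * R) ^ 3 + (|u| * R) ^ 3 := add_le_add hA hB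
    _ = _ := by ring

lemma tendsto_char (Y : B → ℝ) (h0 : 𝔼 b, Y b = 0) (m : ℕ) (hm : 0 < m) (t : ℝ) :
    Tendsto (fun n : ℕ => (𝔼 b, Complex.exp (Complex.I * ((t / √n * Y b : ℝ) : ℂ))) ^ (n / m))
      atTop (𝓝 (Complex.exp ((-((𝔼 b, (Y b) ^ 2) / m * t ^ 2 / 2) : ℝ) : ℂ))) := by
  obtain ⟨C, δ, hδ, hC⟩ := char_est Y h0
  set V := 𝔼 b, (Y b) ^ 2 with hV
  have hV0 : 0 ≤ V := expect_nonneg fun b _ => sq_nonneg _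
  have hsqrt : Tendsto (fun n : ℕ => √(n : ℝ)) atTop atTop :=
    Real.tendsto_sqrt_atTop.comp tendsto_natCast_atTop_atTop
  have hm' : (0 : ℝ) < m := by exact_mod_cast hm
  -- main term
  have hmain : Tendsto (fun n : ℕ => (Complex.exp ((-(V * (t / √n) ^ 2 / 2) : ℝ) : ℂ)) ^ (n / m))
      atTop (𝓝 (Complex.exp ((-(V / m * t ^ 2 / 2) : ℝ) : ℂ))) := by
    have hfl : Tendsto (fun n : ℕ => ((n / m : ℕ) : ℝ) / n) atTop (𝓝 (1 / m : ℝ)) := by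
      have := (tendsto_nat_floor_mul_div_atTop (R := ℝ) (a := 1 / m) (by positivity)).comp
        tendsto_natCast_atTop_atTop
      refine this.congr fun n => ?_
      simp only [Function.comp]
      rw [one_div_mul_eq_div, Nat.floor_div_eq_div]
    have h2 : Tendsto (fun n : ℕ => (-(V * t ^ 2 / 2 * (((n / m : ℕ) : ℝ) / n)) : ℝ)) atTop
        (𝓝 (-(V / m * t ^ 2 / 2))) := by
      have := (hfl.const_mul (V * t ^ 2 / 2)).neg
      convert this using 2
      ring
    have h3 := (Complex.continuous_exp.tendsto _).comp
      ((Complex.continuous_ofReal.tendsto _).comp h2)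
    refine h3.congr' ?_
    filter_upwards [eventually_gt_atTop 0] with n hn
    have hn' : (0 : ℝ) < n := by exact_mod_cast hn
    simp only [Function.comp]
    rw [← Complex.exp_nat_mul]
    congr 1
    have : (t / √n) ^ 2 = t ^ 2 / n := by rw [div_pow, Real.sq_sqrt hn'.le]
    rw [this]
    push_cast
    ring
  refine hmain.congr_dist ?_
  have hz : Tendsto (fun n : ℕ => |C| * |t| ^ 3 * (√(n : ℝ))⁻¹) atTop (𝓝 0) := by
    simpa using (tendsto_inv_atTop_zero.comp hsqrt).const_mul (|C| * |t| ^ 3)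
  have hu : ∀ᶠ n : ℕ in atTop, |t / √(n : ℝ)| ≤ δ := by
    have : Tendsto (fun n : ℕ => |t / √(n : ℝ)|) atTop (𝓝 0) := by
      simpa using (hsqrt.const_div_atTop t).abs
    exact this.eventually_le_const hδ
  refine squeeze_zero' (Eventually.of_forall fun n => dist_nonneg) ?_ hz
  filter_upwards [hu, eventually_gt_atTop 0] with n hun hn
  have hn' : (0 : ℝ) < n := by exact_mod_cast hn
  rw [dist_comm, dist_eq_norm]
  refine (pow_diff _ _ ?_ ?_ _).trans ?_
  · refine (RCLike.norm_expect_le (K := ℂ)).trans (expect_le univ_nonempty fun b _ => ?_)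
    rw [Complex.norm_exp_I_mul_ofReal]
  · rw [← Complex.ofReal_exp, Complex.norm_real, Real.norm_of_nonneg (Real.exp_pos _).le]
    rw [Real.exp_le_one_iff]
    have : 0 ≤ V * (t / √n) ^ 2 / 2 := by positivity
    linarith
  · have hk : ((n / m : ℕ) : ℝ) ≤ n := by exact_mod_cast Nat.div_le_self n m
    have hs : 0 < √(n : ℝ) := Real.sqrt_pos.2 hn'
    calc _ ≤ (n : ℝ) * (|C| * |t / √n| ^ 3) := by
          gcongr
          refine (hC _ hun).trans ?_
          gcongr; exact le_abs_self C
      _ = _ := by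
          rw [abs_div, abs_of_pos hs, div_pow]
          have : (n : ℝ) = √n ^ 2 := (Real.sq_sqrt hn'.le).symm
          field_simp
          rw [← this]
          ring

end Char

section QM2
variable {G : Type*} [Monoid G] {ι : Type*} [Fintype ι] [Nonempty ι]

lemma char_block (φ : G → ℝ) (D : ℝ) (hq : ∀ g h, |φ (g * h) - φ g - φ h| ≤ D)
    (β : ι → G) (K : ℝ) (hK : ∀ a, |φ (β a)| ≤ K) (E : ℝ)
    (hE : ∀ n, |mn φ β n - n * E| ≤ D) (k m r : ℕ) (hr : r < m) (u : ℝ) :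
    ‖𝔼 s : Fin (k * m + r) → ι, Complex.exp (Complex.I *
        ((u * (φ (W β (k * m + r) s) - E * ((k * m + r : ℕ) : ℝ)) : ℝ) : ℂ)) -
      (𝔼 b : Fin m → ι, Complex.exp (Complex.I * ((u * (φ (W β m b) - mn φ β m) : ℝ) : ℂ))) ^ k‖
      ≤ |u| * (2 * D * √k + (3 * D + m * (K + D) + m * |E|)) := by
  have hD : 0 ≤ D := (abs_nonneg _).trans (hq 1 1)
  have hK0 : 0 ≤ K := (abs_nonneg _).trans (hK (Classical.arbitrary ι))
  have hpow : (𝔼 b : Fin m → ι,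
      Complex.exp (Complex.I * ((u * (φ (W β m b) - mn φ β m) : ℝ) : ℂ))) ^ k =
      𝔼 b : Fin k → Fin m → ι, Complex.exp (Complex.I *
        ((u * (∑ j, φ (W β m (b j)) - k * mn φ β m) : ℝ) : ℂ)) := by
    rw [expect_pow, Fintype.piFinset_univ]
    refine expect_congr rfl fun b _ => ?_
    rw [← Complex.exp_sum]
    congr 1
    rw [← mul_sum, ← Complex.ofReal_sum, ← mul_sum, sum_sub_distrib]
    simp
  set Z : (Fin k → Fin m → ι) → ℝ := fun b => (φ (W (W β m) k b) - ∑ j, φ (W β m (b j)))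
    - (mn φ β (k * m) - k * mn φ β m) with hZ
  have hZ2 : 𝔼 b, |Z b| ≤ 2 * D * √k := by
    refine (expect_abs_le_sqrt Z).trans ?_
    have h := var_bound φ D hq (W β m) (fun b => φ (W β m b)) 0 (by simp) k 1
    simp only [one_mul, add_zero] at h
    have hmean : 𝔼 s' : Fin k → Fin m → ι, (φ (W (W β m) k s') - ∑ i, φ (W β m (s' i))) =
        mn φ β (k * m) - k * mn φ β m := by
      rw [expect_sub_distrib]
      congr 1
      · rw [mn, expect_blk]
        simp_rw [W_blk]
      · rw [expect_sum_comm]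
        have : ∀ i : Fin k, 𝔼 s' : Fin k → Fin m → ι, φ (W β m (s' i)) = mn φ β m := by
          intro i
          exact expect_coord (fun b => φ (W β m b)) k i
        simp_rw [this]
        simp
    rw [hmean] at h
    calc √(𝔼 a, Z a ^ 2) ≤ √((2 * D) ^ 2 * k) := Real.sqrt_le_sqrt h
      _ = 2 * D * √k := by
        rw [Real.sqrt_mul (by positivity), Real.sqrt_sq (by positivity)]
  rw [hpow, expect_append]
  rw [expect_blk (M := ℂ), ← expect_sub_distrib]
  refine (RCLike.norm_expect_le (K := ℂ)).trans ?_
  have hb : ∀ b : Fin k → Fin m → ι,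
      ‖𝔼 c : Fin r → ι, Complex.exp (Complex.I * ((u * (φ (W β (k * m + r)
        (Fin.append (blk k m b) c)) - E * ((k * m + r : ℕ) : ℝ)) : ℝ) : ℂ)) -
        Complex.exp (Complex.I * ((u * (∑ j, φ (W β m (b j)) - k * mn φ β m) : ℝ) : ℂ))‖ ≤
      |u| * |Z b| + |u| * (3 * D + m * (K + D) + m * |E|) := by
    intro b
    rw [← Fintype.expect_const (ι := Fin r → ι)
      (Complex.exp (Complex.I * ((u * (∑ j, φ (W β m (b j)) - k * mn φ β m) : ℝ) : ℂ))),
      ← expect_sub_distrib]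
    refine (RCLike.norm_expect_le (K := ℂ)).trans (expect_le univ_nonempty fun c _ => ?_)
    refine (exp_diff _ _).trans ?_
    rw [← mul_sub, abs_mul, ← mul_add]
    refine mul_le_mul_of_nonneg_left ?_ (abs_nonneg u)
    rw [W_append, W_blk]
    have h1 := hq (W (W β m) k b) (W β r c)
    have h2 := W_bound φ D hq β K hK r c
    have h3 := hE (k * m)
    have hr' : (r : ℝ) ≤ m := by exact_mod_cast hr.le
    have h4 : (r : ℝ) * (K + D) ≤ m * (K + D) := by gcongr
    have h5 : |(r : ℝ) * E| ≤ m * |E| := by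
      rw [abs_mul, Nat.abs_cast]; gcongr
    have e : φ (W (W β m) k b * W β r c) - E * ((k * m + r : ℕ) : ℝ) -
        (∑ j, φ (W β m (b j)) - k * mn φ β m) = Z b +
        ((φ (W (W β m) k b * W β r c) - φ (W (W β m) k b) - φ (W β r c)) + φ (W β r c)
        + (mn φ β (k * m) - ((k * m : ℕ) : ℝ) * E) - r * E) := by
      simp only [hZ]; push_cast; ring
    rw [e]
    refine (abs_add_le _ _).trans ?_
    have : |(φ (W (W β m) k b * W β r c) - φ (W (W β m) k b) - φ (W β r c)) + φ (W β r c)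
        + (mn φ β (k * m) - ((k * m : ℕ) : ℝ) * E) - r * E| ≤
        3 * D + m * (K + D) + m * |E| := by
      rw [abs_le] at *
      constructor <;> linarith [h1.1, h1.2, h2.1, h2.2, h3.1, h3.2, h5.1, h5.2]
    linarith
  refine (expect_le_expect fun b _ => hb b).trans ?_
  rw [expect_add_distrib, Fintype.expect_const, ← mul_expect,
    mul_add |u| (2 * D * √k)]
  exact add_le_add (mul_le_mul_of_nonneg_left hZ2 (abs_nonneg u)) le_rfl

end QM2

section QM3
variable {G : Type*} [Monoid G] {ι : Type*} [Fintype ι] [Nonempty ι]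

lemma qm_charFun (φ : G → ℝ) (D : ℝ) (hq : ∀ g h, |φ (g * h) - φ g - φ h| ≤ D) (β : ι → G) :
    ∃ (E v : ℝ), 0 ≤ v ∧ ∀ t : ℝ, Tendsto (fun n : ℕ => 𝔼 s : Fin n → ι,
      Complex.exp (Complex.I * ((t / √n * (φ (W β n s) - E * n) : ℝ) : ℂ))) atTop
      (𝓝 (Complex.exp ((-(v * t ^ 2 / 2) : ℝ) : ℂ))) := by
  have hD : 0 ≤ D := (abs_nonneg _).trans (hq 1 1)
  obtain ⟨K, hK⟩ : ∃ K : ℝ, ∀ a, |φ (β a)| ≤ K :=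
    ⟨∑ a, |φ (β a)|, fun a => single_le_sum (f := fun a => |φ (β a)|)
      (fun _ _ => abs_nonneg _) (mem_univ a)⟩
  obtain ⟨E, hE⟩ := exists_drift (mn φ β) D (mn_add φ D hq β)
  set V : ℕ → ℝ := fun m => 𝔼 b : Fin m → ι, (φ (W β m b) - mn φ β m) ^ 2 with hV
  have hV0 : ∀ m, 0 ≤ V m := fun m => expect_nonneg fun _ _ => sq_nonneg _
  have hVb : ∀ m, V m ≤ (2 * D + K) ^ 2 * m := by
    intro m
    have := var_bound φ D hq β (fun _ => 0) K (by simpa using hK) m 1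
    simpa [hV, mn] using this
  have hvmem : ∀ i : ℕ, V (i + 1) / ((i + 1 : ℕ) : ℝ) ∈ Set.Icc 0 ((2 * D + K) ^ 2) := by
    intro i
    have hp : (0 : ℝ) < ((i + 1 : ℕ) : ℝ) := by positivity
    exact ⟨div_nonneg (hV0 _) hp.le, (div_le_iff₀ hp).2 (hVb _)⟩
  obtain ⟨v, hv, θ, hθ, hlim⟩ := isCompact_Icc.tendsto_subseq hvmem
  refine ⟨E, v, hv.1, fun t => ?_⟩
  rw [Metric.tendsto_atTop]
  intro ε hε
  -- choose the block length
  have hθ' : Tendsto (fun i => θ i + 1) atTop atTop :=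
    (tendsto_add_atTop_nat 1).comp hθ.tendsto_atTop
  have hsq : Tendsto (fun i => √((θ i + 1 : ℕ) : ℝ)) atTop atTop :=
    Real.tendsto_sqrt_atTop.comp (tendsto_natCast_atTop_atTop.comp hθ')
  have ht1 : Tendsto (fun i => |t| * (2 * D) / √((θ i + 1 : ℕ) : ℝ)) atTop (𝓝 0) :=
    hsq.const_div_atTop _
  have ht2 : Tendsto (fun i => Complex.exp
      ((-(V (θ i + 1) / ((θ i + 1 : ℕ) : ℝ) * t ^ 2 / 2) : ℝ) : ℂ)) atTop
      (𝓝 (Complex.exp ((-(v * t ^ 2 / 2) : ℝ) : ℂ))) := by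
    have hc : Continuous fun x : ℝ => Complex.exp ((-(x * t ^ 2 / 2) : ℝ) : ℂ) := by fun_prop
    exact (hc.tendsto v).comp hlim
  obtain ⟨i, hi1, hi2⟩ := ((ht1.eventually_lt_const (by positivity : (0 : ℝ) < ε / 4)).and
    (Metric.tendsto_nhds.1 ht2 (ε / 4) (by positivity))).exists
  set m := θ i + 1 with hm
  have hmpos : 0 < m := by omega
  have hm' : (0 : ℝ) < m := by exact_mod_cast hmpos
  set Cm : ℝ := 3 * D + m * (K + D) + m * |E| with hCm
  have hmean : 𝔼 b : Fin m → ι, (φ (W β m b) - mn φ β m) = 0 := by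
    rw [expect_sub_distrib, Fintype.expect_const, mn, sub_self]
  have ht3 := tendsto_char (fun b : Fin m → ι => φ (W β m b) - mn φ β m) hmean m hmpos t
  have hsn : Tendsto (fun n : ℕ => √(n : ℝ)) atTop atTop :=
    Real.tendsto_sqrt_atTop.comp tendsto_natCast_atTop_atTop
  have ht4 : Tendsto (fun n : ℕ => |t| * Cm / √(n : ℝ)) atTop (𝓝 0) := hsn.const_div_atTop _
  have hev := ((Metric.tendsto_nhds.1 ht3 (ε / 4) (by positivity)).and
    ((ht4.eventually_lt_const (by positivity : (0 : ℝ) < ε / 4)).and (eventually_gt_atTop 0)))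
  obtain ⟨N, hN⟩ := eventually_atTop.1 hev
  refine ⟨N, fun n hn => ?_⟩
  obtain ⟨h3, h4, hnpos⟩ := hN n hn
  have hn' : (0 : ℝ) < n := by exact_mod_cast hnpos
  have hs : 0 < √(n : ℝ) := Real.sqrt_pos.2 hn'
  have hblock := char_block φ D hq β K hK E hE (n / m) m (n % m) (Nat.mod_lt _ hmpos) (t / √n)
  rw [Nat.div_add_mod' n m, ← dist_eq_norm] at hblock
  have hbd : |t / √n| * (2 * D * √((n / m : ℕ) : ℝ) + Cm) ≤
      |t| * (2 * D) / √(m : ℝ) + |t| * Cm / √(n : ℝ) := by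
    have hk : √((n / m : ℕ) : ℝ) ≤ √(n : ℝ) / √(m : ℝ) := by
      rw [← Real.sqrt_div hn'.le]
      exact Real.sqrt_le_sqrt Nat.cast_div_le
    have hsm : 0 < √(m : ℝ) := Real.sqrt_pos.2 hm'
    rw [abs_div, abs_of_pos hs]
    calc |t| / √n * (2 * D * √((n / m : ℕ) : ℝ) + Cm) ≤
          |t| / √n * (2 * D * (√(n : ℝ) / √(m : ℝ)) + Cm) := by gcongr
      _ = _ := by field_simp
  have d1 := dist_triangle4 (𝔼 s : Fin n → ι,
      Complex.exp (Complex.I * ((t / √n * (φ (W β n s) - E * n) : ℝ) : ℂ)))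
    ((𝔼 b : Fin m → ι, Complex.exp (Complex.I *
      ((t / √n * (φ (W β m b) - mn φ β m) : ℝ) : ℂ))) ^ (n / m))
    (Complex.exp ((-(V m / m * t ^ 2 / 2) : ℝ) : ℂ))
    (Complex.exp ((-(v * t ^ 2 / 2) : ℝ) : ℂ))
  linarith

end QM3

section Levy
open MeasureTheory ProbabilityTheory

lemma levy_expect {α : ℕ → Type*} [∀ n, Fintype (α n)] [∀ n, Nonempty (α n)]
    (X : ∀ n, α n → ℝ) (v : NNReal)
    (h : ∀ t : ℝ, Tendsto (fun n : ℕ => 𝔼 s : α n,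
      Complex.exp (Complex.I * ((t * X n s : ℝ) : ℂ))) atTop
      (𝓝 (Complex.exp ((-(v * t ^ 2 / 2) : ℝ) : ℂ))))
    (f : ℝ → ℝ) (hf : Continuous f) (hb : ∃ M : ℝ, ∀ x, |f x| ≤ M) :
    Tendsto (fun n : ℕ => 𝔼 s : α n, f (X n s)) atTop
      (𝓝 (∫ x, f x ∂(gaussianReal 0 v))) := by
  let μ : ∀ n, Measure ℝ := fun n =>
    ((Fintype.card (α n) : ENNReal)⁻¹) • ∑ s : α n, Measure.dirac (X n s)
  have hμ : ∀ n, IsProbabilityMeasure (μ n) := by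
    intro n
    constructor
    simp only [μ, Measure.smul_apply, Measure.finsetSum_apply, measure_univ, sum_const, card_univ,
      nsmul_eq_mul, mul_one, smul_eq_mul]
    exact ENNReal.inv_mul_cancel (by simp) (by simp)
  have hint : ∀ (n : ℕ) (F : Type) [NormedAddCommGroup F] [NormedSpace ℝ F] [CompleteSpace F]
      (g : ℝ → F), Continuous g →
      ∫ x, g x ∂(μ n) = ((Fintype.card (α n) : ℝ)⁻¹) • ∑ s : α n, g (X n s) := by
    intro n F _ _ _ g hg
    simp only [μ]
    rw [integral_smul_measure, integral_finsetSum_measure]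
    · simp [integral_dirac]
    · intro s _
      exact integrable_dirac (by simp)
  let P : ℕ → ProbabilityMeasure ℝ := fun n => ⟨μ n, hμ n⟩
  let Q : ProbabilityMeasure ℝ := ⟨gaussianReal 0 v, inferInstance⟩
  have hP : ∀ n, (P n : Measure ℝ) = μ n := fun n => rfl
  have hQ : (Q : Measure ℝ) = gaussianReal 0 v := rfl
  have key : Tendsto P atTop (𝓝 Q) := by
    rw [ProbabilityMeasure.tendsto_iff_tendsto_charFun]
    intro t
    have e1 : ∀ n, charFun (μ n) t = 𝔼 s : α n, Complex.exp (Complex.I * ((t * X n s : ℝ) : ℂ)) := by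
      intro n
      rw [charFun_apply_real, hint n ℂ _ (by fun_prop), Fintype.expect_eq_sum_div_card,
        div_eq_inv_mul]
      rw [Complex.real_smul]
      push_cast
      congr 1
      refine sum_congr rfl fun s _ => ?_
      congr 1
      ring
    have e2 : charFun (gaussianReal 0 v) t = Complex.exp ((-(v * t ^ 2 / 2) : ℝ) : ℂ) := by
      rw [charFun_gaussianReal]
      congr 1
      push_cast
      simp
    simp only [hP, hQ, e1, e2]
    exact h t
  rw [ProbabilityMeasure.tendsto_iff_forall_integral_tendsto] at key
  obtain ⟨M, hM⟩ := hb
  have := key (BoundedContinuousFunction.ofNormedAddCommGroup f hf M (by simpa using hM))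
  simp only [hP, hQ, BoundedContinuousFunction.coe_ofNormedAddCommGroup] at this
  refine this.congr fun n => ?_
  rw [hint n ℝ f hf, Fintype.expect_eq_sum_div_card, div_eq_inv_mul, smul_eq_mul]

end Levy

lemma tau_qm (g h : CircleDeg1Liftˣ) :
    |CircleDeg1Lift.translationNumber ((g * h : CircleDeg1Liftˣ) : CircleDeg1Lift)
      - CircleDeg1Lift.translationNumber (g : CircleDeg1Lift)
      - CircleDeg1Lift.translationNumber (h : CircleDeg1Lift)| ≤ 4 := by
  have h1 := CircleDeg1Lift.dist_map_zero_translationNumber_le (g : CircleDeg1Lift)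
  have h2 := CircleDeg1Lift.dist_map_zero_translationNumber_le (h : CircleDeg1Lift)
  have h3 := CircleDeg1Lift.dist_map_zero_translationNumber_le
    ((g * h : CircleDeg1Liftˣ) : CircleDeg1Lift)
  have h4 := CircleDeg1Lift.dist_map_map_zero_lt (g : CircleDeg1Lift) (h : CircleDeg1Lift)
  rw [Units.val_mul, CircleDeg1Lift.mul_apply] at h3
  rw [Units.val_mul]
  rw [Real.dist_eq] at *
  rw [abs_lt] at h4
  rw [abs_le] at *
  constructor <;> linarith [h1.1, h1.2, h2.1, h2.2, h3.1, h3.2, h4.1, h4.2]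

theorem rotation_number_clt
    (H : Subgroup CircleDeg1Liftˣ) (Sb : Finset H) (hne : Sb.Nonempty)
    (hgen : Subgroup.closure (Sb : Set H) = ⊤) :
    ∃ (E : ℝ) (σ : NNReal),
      ∀ f : ℝ → ℝ, Continuous f → (∃ M : ℝ, ∀ x, |f x| ≤ M) →
        Filter.Tendsto
          (fun n : ℕ =>
            ((Sb.card : ℝ) ^ n)⁻¹ *
              ∑ s : Fin n → {x // x ∈ Sb},
                f ((CircleDeg1Lift.translationNumber
                      (((walkEnd fun i => ((s i : H) : CircleDeg1Liftˣ)) :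
                          CircleDeg1Liftˣ) : CircleDeg1Lift)
                    - E * n) / Real.sqrt n))
          Filter.atTop
          (nhds (∫ x, f x ∂(ProbabilityTheory.gaussianReal 0 (σ ^ 2)))) := by
  have : Nonempty {x // x ∈ Sb} := hne.to_subtype
  obtain ⟨E, v, hv, h⟩ := qm_charFun
    (fun g : CircleDeg1Liftˣ => CircleDeg1Lift.translationNumber (g : CircleDeg1Lift)) 4 tau_qm
    (fun x : {x // x ∈ Sb} => ((x : H) : CircleDeg1Liftˣ))
  lift v to NNReal using hv
  refine ⟨E, NNReal.sqrt v, fun f hf hb => ?_⟩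
  rw [NNReal.sq_sqrt]
  have := levy_expect (α := fun n => Fin n → {x // x ∈ Sb}) (fun n s =>
    (CircleDeg1Lift.translationNumber ((W (fun x : {x // x ∈ Sb} => ((x : H) : CircleDeg1Liftˣ)) n s
      : CircleDeg1Liftˣ) : CircleDeg1Lift) - E * n) / Real.sqrt n) v (fun t => ?_) f hf hb
  · refine this.congr fun n => ?_
    rw [Fintype.expect_eq_sum_div_card, div_eq_inv_mul]
    congr 1
    simp
  · refine (h t).congr fun n => ?_
    refine expect_congr rfl fun s _ => ?_
    congr 3
    ring

end SclPaper
end
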